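/- arXiv:2503.16830 — 2 statements merged into one kernel-verified Lean document; each statement's English description precedes it below -/
import Mathlib

section
/- Let K be a local field of characteristic p > 0 with perfect residue field, let 1 ≤ r ≤ n-1, and let a = (0, …, 0, a_r, …, a_{n-1}) ∈ W_n(K) be a strongly reduced Witt vector with a_r ≠ 0 and v_K(a_r) < 0; set m_i = -v_K(a_i) for r ≤ i ≤ n-1. Then the largest upper ramification break of K[a]/K equals max{p^{n-1-r} m_r, p^{n-2-r} m_{r+1}, …, p m_{n-2}, m_{n-1}}, where terms with a_i = 0 are omitted from the maximum. -/
noncomputable section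

open scoped Classical

/-- The normalized valuation on `k((t))`: `v(x)` is the order of vanishing of `x`,
with `v(0) = ∞`. -/
def lsVal {k : Type*} [Field k] (x : LaurentSeries k) : WithTop ℤ :=
  if x = 0 then ⊤ else (x.order : WithTop ℤ)

/-- The normalized valuation `v_K` on a local field `K` presented by an isomorphism
`ι : K ≃ k((t))`. -/
def lfVal {K k : Type*} [Field K] [Field k] (ι : K ≃+* LaurentSeries k) (x : K) :
    WithTop ℤ :=
  lsVal (ι x)

/-- `v : L → ℤ ∪ {∞}` is a normalized discrete valuation on the field `L`:
`v x = ∞` iff `x = 0`, `v` is multiplicative, satisfies the ultrametric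
inequality, and `v(L^×) = ℤ` (there is a uniformizer of valuation `1`). -/
def IsNormVal {L : Type*} [Field L] (v : L → WithTop ℤ) : Prop :=
  (∀ x, v x = ⊤ ↔ x = 0) ∧
  (∀ x y, v (x * y) = v x + v y) ∧
  (∀ x y, min (v x) (v y) ≤ v (x + y)) ∧
  (∃ π, v π = (1 : ℤ))

/-- The valuation `v` on `L` restricts on `K` to `e` times the normalized valuation
`vK` of `K`; thus `e = e_{L/K}` is the ramification index of `L/K`. -/
def ExtendsWithE {K L : Type*} [Field K] [Field L] [Algebra K L]
    (vK : K → WithTop ℤ) (v : L → WithTop ℤ) (e : ℕ) : Prop :=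
  ∀ (x : K) (z : ℤ), vK x = (z : WithTop ℤ) →
    v (algebraMap K L x) = (((e : ℤ) * z : ℤ) : WithTop ℤ)

/-- `σ` lies in the inertia subgroup `G_0` of `Gal(L/F)`: `σ` induces the identity
on the residue field. -/
def InInertia {F L : Type*} [Field F] [Field L] [Algebra F L]
    (v : L → WithTop ℤ) (σ : L ≃ₐ[F] L) : Prop :=
  ∀ x : L, 0 ≤ v x → (1 : ℤ) ≤ v (σ x - x)

/-- The ramification group `G_x = {σ ∈ G_0 : v_L(σ(π_L) - π_L) ≥ x + 1}` of `Gal(L/F)`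
in the lower numbering (for real `x`); since `v_L` is integer valued, the condition
`v_L(σ(π_L) - π_L) ≥ x + 1` is expressed via the ceiling `⌈x + 1⌉`. -/
def ramGrp (F : Type*) {L : Type*} [Field F] [Field L] [Algebra F L]
    (v : L → WithTop ℤ) (π : L) (x : ℝ) : Set (L ≃ₐ[F] L) :=
  {σ | InInertia v σ ∧ ((⌈x + 1⌉ : ℤ) : WithTop ℤ) ≤ v (σ π - π)}

/-- The Hasse–Herbrand function `φ_{L/F}(x) = ∫_0^x dt / (G_0 : G_t)`, where
`1/(G_0 : G_t) = |G_t|/|G_0|`. -/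
def hhPhi (F : Type*) {L : Type*} [Field F] [Field L] [Algebra F L]
    (v : L → WithTop ℤ) (π : L) (x : ℝ) : ℝ :=
  ∫ t in (0 : ℝ)..x, ((ramGrp F v π t).ncard : ℝ) / ((ramGrp F v π 0).ncard : ℝ)

/-- `ψ_{L/F}`, the inverse of the Hasse–Herbrand bijection `φ_{L/F} : ℝ_{≥0} → ℝ_{≥0}`. -/
def hhPsi (F : Type*) {L : Type*} [Field F] [Field L] [Algebra F L]
    (v : L → WithTop ℤ) (π : L) (u : ℝ) : ℝ :=
  Function.invFunOn (hhPhi F v π) (Set.Ici 0) u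

/-- The ramification group `G^u = G_{ψ_{L/F}(u)}` in the upper numbering. -/
def upperRamGrp (F : Type*) {L : Type*} [Field F] [Field L] [Algebra F L]
    (v : L → WithTop ℤ) (π : L) (u : ℝ) : Set (L ≃ₐ[F] L) :=
  ramGrp F v π (hhPsi F v π u)

/-- `b` is a lower ramification break of `L/F`: `b ≥ 0` and `G_{b+ε} ≠ G_b` for all
`ε > 0`. -/
def IsLowerBreak (F : Type*) {L : Type*} [Field F] [Field L] [Algebra F L]
    (v : L → WithTop ℤ) (π : L) (b : ℝ) : Prop :=
  0 ≤ b ∧ ∀ ε : ℝ, 0 < ε → ramGrp F v π (b + ε) ≠ ramGrp F v π b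

/-- `u` is an upper ramification break of `L/F`: `u ≥ 0` and `G^{u+ε} ≠ G^u` for all
`ε > 0`. -/
def IsUpperBreak (F : Type*) {L : Type*} [Field F] [Field L] [Algebra F L]
    (v : L → WithTop ℤ) (π : L) (u : ℝ) : Prop :=
  0 ≤ u ∧ ∀ ε : ℝ, 0 < ε → upperRamGrp F v π (u + ε) ≠ upperRamGrp F v π u

/-- A separable closure `K^sep` of `K`. -/
abbrev SepCl (K : Type*) [Field K] : Type _ :=
  separableClosure K (AlgebraicClosure K)

/-- The Frobenius `F` on truncated Witt vectors, induced by the `p`-th power map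
on components. -/
def wittF {p n : ℕ} {R : Type*} [CommRing R] (x : TruncatedWittVector p n R) :
    TruncatedWittVector p n R :=
  TruncatedWittVector.mk p fun i => x.coeff i ^ p

/-- Componentwise application of a map (the inclusion `W_n(K) → W_n(K^sep)` and the
Galois action on Witt vectors are componentwise). -/
def wittMap {p n : ℕ} {R S : Type*} (f : R → S) (x : TruncatedWittVector p n R) :
    TruncatedWittVector p n S :=
  TruncatedWittVector.mk p fun i => f (x.coeff i)

set_option linter.unusedSectionVars false
namespace S15

section Val
variable {L : Type*} [Field L] {v : L → WithTop ℤ}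

/-- `v x ≥ z`. -/
def VGe (v : L → WithTop ℤ) (x : L) (z : ℤ) : Prop := (z : WithTop ℤ) ≤ v x
/-- `v x = z`. -/
def VEq (v : L → WithTop ℤ) (x : L) (z : ℤ) : Prop := v x = (z : WithTop ℤ)

lemma VEq.ge {x : L} {z : ℤ} (h : VEq v x z) : VGe v x z := by
  unfold VGe; rw [h]

lemma VGe.mono {x : L} {z y : ℤ} (h : VGe v x z) (hy : y ≤ z) : VGe v x y :=
  le_trans (WithTop.coe_le_coe.2 hy) h

lemma VEq.ge_iff {x : L} {z y : ℤ} (h : VEq v x z) : VGe v x y ↔ y ≤ z := by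
  unfold VGe; rw [h]; exact WithTop.coe_le_coe

lemma VEq.unique {x : L} {z y : ℤ} (h : VEq v x z) (h' : VEq v x y) : z = y := by
  unfold VEq at *; rw [h] at h'; exact WithTop.coe_injective h'

lemma vge_zero (hv : IsNormVal v) (z : ℤ) : VGe v 0 z := by
  unfold VGe; rw [(hv.1 0).2 rfl]; exact le_top

lemma exists_veq (hv : IsNormVal v) {x : L} (hx : x ≠ 0) : ∃ z, VEq v x z := by
  have : v x ≠ ⊤ := fun h => hx ((hv.1 x).1 h)
  obtain ⟨z, hz⟩ := WithTop.ne_top_iff_exists.1 this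
  exact ⟨z, hz.symm⟩

lemma VEq.ne_zero (hv : IsNormVal v) {x : L} {z : ℤ} (h : VEq v x z) : x ≠ 0 := by
  rintro rfl
  unfold VEq at h
  rw [(hv.1 0).2 rfl] at h
  exact WithTop.top_ne_coe h

lemma VGe.add (hv : IsNormVal v) {x y : L} {z : ℤ} (hx : VGe v x z) (hy : VGe v y z) :
    VGe v (x + y) z := le_trans (le_min hx hy) (hv.2.2.1 x y)

lemma VGe.mul (hv : IsNormVal v) {x y : L} {z z' : ℤ} (hx : VGe v x z) (hy : VGe v y z') :
    VGe v (x * y) (z + z') := by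
  unfold VGe at *
  rw [hv.2.1, WithTop.coe_add]
  exact add_le_add hx hy

lemma VEq.mul (hv : IsNormVal v) {x y : L} {z z' : ℤ} (hx : VEq v x z) (hy : VEq v y z') :
    VEq v (x * y) (z + z') := by
  unfold VEq at *
  rw [hv.2.1, WithTop.coe_add, hx, hy]

lemma veq_one (hv : IsNormVal v) : VEq v 1 0 := by
  obtain ⟨z, hz⟩ := exists_veq hv (one_ne_zero (α := L))
  have h := hz.mul hv hz
  rw [mul_one] at h
  have := hz.unique h
  have : z = 0 := by omega
  rwa [this] at hz

lemma veq_neg_one (hv : IsNormVal v) : VEq v (-1) 0 := by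
  obtain ⟨z, hz⟩ := exists_veq hv (neg_ne_zero.2 (one_ne_zero (α := L)))
  have h := hz.mul hv hz
  rw [neg_one_mul, neg_neg] at h
  have := (veq_one hv).unique h
  have : z = 0 := by omega
  rwa [this] at hz

lemma VEq.neg (hv : IsNormVal v) {x : L} {z : ℤ} (hx : VEq v x z) : VEq v (-x) z := by
  have := (veq_neg_one hv).mul hv hx
  rwa [neg_one_mul, zero_add] at this

lemma VGe.neg (hv : IsNormVal v) {x : L} {z : ℤ} (hx : VGe v x z) : VGe v (-x) z := by
  have := (veq_neg_one hv).ge.mul hv hx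
  rwa [neg_one_mul, zero_add] at this

lemma VGe.sub (hv : IsNormVal v) {x y : L} {z : ℤ} (hx : VGe v x z) (hy : VGe v y z) :
    VGe v (x - y) z := by
  rw [sub_eq_add_neg]; exact hx.add hv (hy.neg hv)

lemma VEq.add_ge (hv : IsNormVal v) {x y : L} {z : ℤ} (hx : VEq v x z) (hy : VGe v y (z + 1)) :
    VEq v (x + y) z := by
  have h1 : VGe v (x + y) z := hx.ge.add hv (hy.mono (by omega))
  have h2 : ¬ VGe v (x + y) (z + 1) := by
    intro h
    have h3 := h.sub hv hy
    rw [add_sub_cancel_right, hx.ge_iff] at h3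
    omega
  have hne : x + y ≠ 0 := by
    intro h; rw [h] at h2; exact h2 (vge_zero hv _)
  obtain ⟨w, hw⟩ := exists_veq hv hne
  rw [hw.ge_iff] at h1 h2
  have : w = z := by omega
  rwa [this] at hw

lemma VEq.pow (hv : IsNormVal v) {x : L} {z : ℤ} (hx : VEq v x z) (n : ℕ) :
    VEq v (x ^ n) (n * z) := by
  induction n with
  | zero => simpa using veq_one hv
  | succ n ih =>
    rw [pow_succ]
    have := ih.mul hv hx
    convert this using 1
    push_cast; ring

lemma VGe.pow (hv : IsNormVal v) {x : L} {z : ℤ} (hx : VGe v x z) (n : ℕ) :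
    VGe v (x ^ n) (n * z) := by
  induction n with
  | zero => simpa using (veq_one hv).ge
  | succ n ih =>
    rw [pow_succ]
    have := ih.mul hv hx
    convert this using 1
    push_cast; ring

lemma VEq.inv (hv : IsNormVal v) {x : L} {z : ℤ} (hx : VEq v x z) : VEq v x⁻¹ (-z) := by
  have h0 := hx.ne_zero hv
  obtain ⟨w, hw⟩ := exists_veq hv (inv_ne_zero h0)
  have := hx.mul hv hw
  rw [mul_inv_cancel₀ h0] at this
  have := this.unique (veq_one hv)
  have : w = -z := by omega
  rwa [this] at hw

lemma VEq.zpow (hv : IsNormVal v) {x : L} {z : ℤ} (hx : VEq v x z) (n : ℤ) :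
    VEq v (x ^ n) (n * z) := by
  obtain ⟨m, rfl | rfl⟩ := n.eq_nat_or_neg
  · simpa using hx.pow hv m
  · rw [zpow_neg, zpow_natCast]
    convert (hx.pow hv m).inv hv using 1
    ring

lemma vge_sum (hv : IsNormVal v) {ι : Type*} (s : Finset ι) (f : ι → L) {z : ℤ}
    (h : ∀ i ∈ s, VGe v (f i) z) : VGe v (∑ i ∈ s, f i) z := by
  induction s using Finset.induction_on with
  | empty => simpa using vge_zero hv z
  | insert a s ha ih =>
    rw [Finset.sum_insert ha]
    exact (h a (by simp)).add hv (ih fun i hi => h i (by simp [hi]))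

lemma vge_prod (hv : IsNormVal v) {ι : Type*} (s : Finset ι) (f : ι → L) (g : ι → ℤ)
    (h : ∀ i ∈ s, VGe v (f i) (g i)) : VGe v (∏ i ∈ s, f i) (∑ i ∈ s, g i) := by
  induction s using Finset.induction_on with
  | empty => simpa using (veq_one hv).ge
  | insert a s ha ih =>
    rw [Finset.prod_insert ha, Finset.sum_insert ha]
    exact (h a (by simp)).mul hv (ih fun i hi => h i (by simp [hi]))

/-- Unique minimum: sum has the valuation of the strictly dominating term. -/
lemma veq_sum_of (hv : IsNormVal v) {ι : Type*} (s : Finset ι) (f : ι → L) {z : ℤ} (i₀ : ι)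
    (h0 : i₀ ∈ s) (hz : VEq v (f i₀) z) (h : ∀ i ∈ s, i ≠ i₀ → VGe v (f i) (z + 1)) :
    VEq v (∑ i ∈ s, f i) z := by
  rw [← Finset.add_sum_erase s f h0]
  apply hz.add_ge hv
  apply vge_sum hv
  intro i hi
  rw [Finset.mem_erase] at hi
  exact h i hi.2 hi.1

/-- If the nonzero terms have pairwise distinct valuations, one term strictly dominates. -/
lemma exists_dominant (hv : IsNormVal v) {ι : Type*} (s : Finset ι) (f : ι → L)
    (hne : ∃ i ∈ s, f i ≠ 0)
    (hd : ∀ i ∈ s, ∀ j ∈ s, ∀ z, VEq v (f i) z → VEq v (f j) z → i = j) :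
    ∃ i₀ ∈ s, ∃ z, VEq v (f i₀) z ∧ ∀ i ∈ s, i ≠ i₀ → VGe v (f i) (z + 1) := by
  obtain ⟨i1, hi1, hf1⟩ := hne
  obtain ⟨i₀, h0, hmin⟩ := Finset.exists_min_image s (fun i => v (f i)) ⟨i1, hi1⟩
  have hne0 : f i₀ ≠ 0 := by
    intro h
    have := hmin i1 hi1
    rw [(hv.1 _).2 h] at this
    exact hf1 ((hv.1 _).1 (top_le_iff.1 this))
  obtain ⟨z, hz⟩ := exists_veq hv hne0
  refine ⟨i₀, h0, z, hz, fun i hi hii => ?_⟩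
  by_cases hfi : f i = 0
  · rw [hfi]; exact vge_zero hv _
  obtain ⟨y, hy⟩ := exists_veq hv hfi
  have h1 := hmin i hi
  rw [hz, hy] at h1
  have h1 : z ≤ y := WithTop.coe_le_coe.1 h1
  rw [hy.ge_iff]
  rcases h1.lt_or_eq with h | h
  · omega
  · subst h; exact absurd (hd i hi i₀ h0 z hy hz) hii

/-- Artin-Schreier equations and valuations. -/
lemma as_veq (hv : IsNormVal v) {p : ℕ} (hp : 2 ≤ p) {w β : L} (h : w ^ p - w = β) {z : ℤ}
    (hz : VEq v β z) (hneg : z < 0) : ∃ y, z = p * y ∧ VEq v w y := by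
  have hw0 : w ≠ 0 := by
    rintro rfl
    rw [zero_pow (by omega), sub_zero] at h
    exact hz.ne_zero hv h.symm
  obtain ⟨y, hy⟩ := exists_veq hv hw0
  have hpz : (2 : ℤ) ≤ p := by exact_mod_cast hp
  by_cases hyn : 0 ≤ y
  · have h1 : VGe v β 0 := by
      rw [← h]
      refine VGe.sub hv ?_ (hy.ge.mono hyn)
      exact (hy.pow hv p).ge.mono (by positivity)
    rw [hz.ge_iff] at h1; omega
  · have h1 : VEq v β (p * y) := by
      rw [← h, sub_eq_add_neg]
      refine (hy.pow hv p).add_ge hv ((hy.neg hv).ge.mono ?_)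
      nlinarith
    exact ⟨y, hz.unique h1, hy⟩

lemma as_vge (hv : IsNormVal v) {p : ℕ} (hp : 2 ≤ p) {w β : L} (h : w ^ p - w = β) {B : ℤ}
    (hB : 0 ≤ B) (hz : VGe v β (-B)) : ∃ y, -B ≤ p * y ∧ VGe v w y := by
  by_cases hw0 : w = 0
  · exact ⟨0, by simpa, by rw [hw0]; exact vge_zero hv _⟩
  obtain ⟨y, hy⟩ := exists_veq hv hw0
  have hpz : (2 : ℤ) ≤ p := by exact_mod_cast hp
  by_cases hyn : 0 ≤ y
  · exact ⟨y, by nlinarith, hy.ge⟩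
  · have h1 : VEq v β (p * y) := by
      rw [← h, sub_eq_add_neg]
      refine (hy.pow hv p).add_ge hv ((hy.neg hv).ge.mono ?_)
      nlinarith
    rw [h1.ge_iff] at hz
    exact ⟨y, hz, hy.ge⟩

/-- `(1+δ)^i - 1`-type estimate. -/
lemma veq_pow_sub (hv : IsNormVal v) {p : ℕ} [Fact p.Prime] [CharP L p] {w w' : L} {y g : ℤ}
    (hg : 0 < g) (hw : VEq v w y) (hd : VEq v (w' - w) (y + g)) (i : ℕ) (hi0 : i ≠ 0)
    (hi : i < p) : VEq v (w' ^ i - w ^ i) (i * y + g) := by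
  have key : ∀ i : ℕ, VGe v (w' ^ i - w ^ i - i * w ^ (i - 1) * (w' - w)) (i * y + g + 1) := by
    intro i
    have hw' : VEq v w' y := by
      have := hw.add_ge hv (hd.ge.mono (by omega : y + 1 ≤ y + g))
      simpa using this
    induction i with
    | zero => simpa using vge_zero hv _
    | succ i ih =>
      have hnat : ∀ n : ℕ, VGe v (n : L) 0 := by
        intro n
        induction n with
        | zero => simpa using vge_zero hv _
        | succ n ih => push_cast; exact ih.add hv (veq_one hv).ge
      have e : w' ^ (i + 1) - w ^ (i + 1) - ((i + 1 : ℕ) : L) * w ^ (i + 1 - 1) * (w' - w) =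
          w' * (w' ^ i - w ^ i - i * w ^ (i - 1) * (w' - w))
            + (i * w ^ (i - 1)) * (w' - w) * (w' - w) := by
        rcases i with _ | i
        · simp
        · simp only [Nat.add_sub_cancel]; push_cast; ring
      rw [e]
      refine VGe.add hv ((hw'.ge.mul hv ih).mono ?_) ?_
      · push_cast; linarith
      · rcases i with _ | i
        · simpa using vge_zero hv _
        · have := (((hnat (i+1)).mul hv ((hw.pow hv i).ge)).mul hv hd.ge).mul hv hd.ge
          refine this.mono ?_
          push_cast; linarith
  have hci : VEq v (i : L) 0 := by
    -- i is a nonzero element of the prime field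
    have hne : (i : L) ≠ 0 := by
      intro h
      rw [CharP.cast_eq_zero_iff L p] at h
      exact absurd (Nat.le_of_dvd (by omega) h) (by omega)
    obtain ⟨z, hz⟩ := exists_veq hv hne
    have hfr : (i : L) ^ p = i := by
      have := (Nat.cast_pow (α := L) i p).symm
      rw [this]
      have hz := ZMod.pow_card (p := p) (i : ZMod p)
      have h2 : ((i ^ p : ℕ) : ZMod p) = (i : ℕ) := by push_cast; exact hz
      have h3 := (ZMod.natCast_eq_natCast_iff _ _ _).1 h2
      exact (CharP.natCast_eq_natCast L p).2 h3
    have h1 := hz.pow hv p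
    rw [hfr] at h1
    have h2 := hz.unique h1
    have hp2 : (2 : ℤ) ≤ p := by exact_mod_cast (Fact.out : p.Prime).two_le
    have : z = 0 := by
      have : (p - 1 : ℤ) * z = 0 := by linarith
      rcases mul_eq_zero.1 this with h | h
      · omega
      · exact h
    rwa [this] at hz
  have h1 : VEq v (i * w ^ (i - 1) * (w' - w)) (i * y + g) := by
    have := (hci.mul hv (hw.pow hv (i - 1))).mul hv hd
    convert this using 1
    obtain ⟨j, rfl⟩ := Nat.exists_eq_succ_of_ne_zero hi0
    push_cast; simp; ring
  have := h1.add_ge hv (key i)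
  convert this using 1
  ring

end Val
end S15

namespace S15

section Euler
variable {k : Type*} [Field k]

/-- The Euler operator `t d/dt` on Laurent series. -/
def eulerFun (f : LaurentSeries k) : LaurentSeries k where
  coeff n := (n : k) * f.coeff n
  isPWO_support' := f.isPWO_support.mono (by
    intro n hn
    simp only [Function.mem_support, ne_eq, HahnSeries.mem_support] at *
    exact fun h => hn (by rw [h, mul_zero]))

lemma eulerFun_coeff (f : LaurentSeries k) (n : ℤ) :
    (eulerFun f).coeff n = (n : k) * f.coeff n := rfl

lemma eulerFun_support (f : LaurentSeries k) : (eulerFun f).support ⊆ f.support := by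
  intro n hn
  simp only [HahnSeries.mem_support, ne_eq, eulerFun_coeff] at *
  exact fun h => hn (by rw [h, mul_zero])

lemma eulerFun_add (f g : LaurentSeries k) : eulerFun (f + g) = eulerFun f + eulerFun g := by
  ext n
  simp only [eulerFun_coeff, HahnSeries.coeff_add, mul_add]

lemma eulerFun_mul (f g : LaurentSeries k) :
    eulerFun (f * g) = f * eulerFun g + g * eulerFun f := by
  ext n
  rw [HahnSeries.coeff_add, mul_comm g, eulerFun_coeff, HahnSeries.coeff_mul,
    HahnSeries.coeff_mul_left' f.isPWO_support (eulerFun_support f),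
    HahnSeries.coeff_mul_right' g.isPWO_support (eulerFun_support g),
    Finset.mul_sum, ← Finset.sum_add_distrib]
  refine Finset.sum_congr rfl fun ij hij => ?_
  simp only [eulerFun_coeff]
  have : ij.1 + ij.2 = n := by
    exact (Finset.mem_antidiagonal.1 hij).2.2
  rw [← this]; push_cast; ring

/-- The Euler derivation transported to `K`. -/
def eulerDer {K : Type*} [Field K] (ι : K ≃+* LaurentSeries k) : Derivation ℤ K K :=
  Derivation.mk'
    (AddMonoidHom.toIntLinearMap
      { toFun := fun x => ι.symm (eulerFun (ι x))
        map_zero' := by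
          have : eulerFun (0 : LaurentSeries k) = 0 := by
            ext n; simp [eulerFun_coeff]
          simp [this]
        map_add' := fun x y => by simp [eulerFun_add] })
    (fun a b => by simp [eulerFun_mul])

lemma eulerDer_apply {K : Type*} [Field K] (ι : K ≃+* LaurentSeries k) (x : K) :
    ι (eulerDer ι x) = eulerFun (ι x) := by
  change ι (ι.symm _) = _
  simp

/-- Derivations extend along separable extensions. -/
lemma exists_extend_der {K L : Type*} [Field K] [Field L] [Algebra K L] [Algebra.IsSeparable K L]
    (D : Derivation ℤ K K) :
    ∃ D' : Derivation ℤ L L, ∀ x : K, D' (algebraMap K L x) = algebraMap K L (D x) := by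
  have : Algebra.FormallyEtale K L := Algebra.FormallyEtale.of_isSeparable K L
  let φ := KaehlerDifferential.tensorKaehlerEquivOfFormallyEtale ℤ K L
  let g : KaehlerDifferential ℤ K →ₗ[K] L := (Algebra.linearMap K L).comp D.liftKaehlerDifferential
  let h : TensorProduct K L (KaehlerDifferential ℤ K) →ₗ[L] L :=
    TensorProduct.AlgebraTensorModule.lift ((LinearMap.toSpanSingleton L (_ →ₗ[K] L) g))
  refine ⟨(h.comp φ.symm.toLinearMap).compDer (KaehlerDifferential.D ℤ L), fun x => ?_⟩
  have := KaehlerDifferential.tensorKaehlerEquivOfFormallyEtale_symm_D_algebraMap ℤ K L x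
  simp [φ, h, this, g]

end Euler

section Base
variable {k : Type*} [Field k] {K : Type*} [Field K] (ι : K ≃+* LaurentSeries k)
  {L : Type*} [Field L] [Algebra K L] {v : L → WithTop ℤ}

/-- constants -/
def kap (L : Type*) [Field L] [Algebra K L] : k →+* L :=
  (algebraMap K L).comp ((ι.symm : LaurentSeries k →+* K).comp HahnSeries.C)

lemma lfVal_of_ne {x : K} (hx : x ≠ 0) : lfVal ι x = ((ι x).order : ℤ) := by
  have : ι x ≠ 0 := by simpa using hx
  simp [lfVal, lsVal, this]

lemma base_veq {e : ℕ} (he : ExtendsWithE (lfVal ι) v e) {x : K} (hx : x ≠ 0) :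
    VEq v (algebraMap K L x) (e * (ι x).order) := he x _ (lfVal_of_ne ι hx)

/-- `v(x) ≥ e z` for `x` in `K` whose coefficients below `z` vanish. -/
lemma base_vge (hv : IsNormVal v) {e : ℕ} (he : ExtendsWithE (lfVal ι) v e) {x : K} {z : ℤ}
    (hx : ∀ n < z, (ι x).coeff n = 0) : VGe v (algebraMap K L x) (e * z) := by
  by_cases h0 : x = 0
  · rw [h0, map_zero]; exact vge_zero hv _
  have h1 : ι x ≠ 0 := by simpa using h0
  rw [(base_veq ι he h0).ge_iff]
  apply mul_le_mul_of_nonneg_left _ (by positivity)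
  exact (HahnSeries.le_order_iff_forall h1).2 hx

lemma e_pos (hv : IsNormVal v) {e : ℕ} (he : ExtendsWithE (lfVal ι) v e)
    [Algebra.IsAlgebraic K L] : 0 < e := by
  rcases Nat.eq_zero_or_pos e with h | h
  swap
  · exact h
  subst h
  exfalso
  have hK : ∀ x : K, x ≠ 0 → VEq v (algebraMap K L x) 0 := by
    intro x hx; simpa using base_veq ι he hx
  have hK' : ∀ x : K, VGe v (algebraMap K L x) 0 := by
    intro x
    by_cases hx : x = 0
    · rw [hx, map_zero]; exact vge_zero hv _
    · exact (hK x hx).ge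
  obtain ⟨π, hπ⟩ := hv.2.2.2
  have hπ : VEq v π 1 := hπ
  have hIgr : IsIntegral K π := Algebra.IsIntegral.isIntegral π
  set P := minpoly K π
  have h0 : P.coeff 0 ≠ 0 := minpoly.coeff_zero_ne_zero hIgr (hπ.ne_zero hv)
  have hP : Polynomial.aeval π P = 0 := minpoly.aeval K π
  rw [← Polynomial.divX_mul_X_add P] at hP
  simp only [map_add, map_mul, Polynomial.aeval_X, Polynomial.aeval_C] at hP
  have h1 : VGe v (Polynomial.aeval π P.divX) 0 := by
    rw [Polynomial.aeval_eq_sum_range]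
    apply vge_sum hv
    intro i _
    rw [Algebra.smul_def]
    have := (hK' (P.divX.coeff i)).mul hv (hπ.ge.pow hv i)
    exact this.mono (by simp)
  have h2 := h1.mul hv hπ.ge
  have h3 := (hK _ h0).add_ge hv h2
  rw [add_comm] at h3
  exact h3.ne_zero hv hP

end Base
end S15

namespace S15

section Layer
variable {k K L : Type*} [Field k] [Field K] [Field L] [Algebra K L]

/-- An additive operator `T` raises valuations on `M` by `E * c`, exactly on elements of
valuation prime to `p`. -/
structure OpGood (v : L → WithTop ℤ) (p : ℕ) (M : IntermediateField K L) (E : ℤ) (T : L → L)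
    (c : ℤ) : Prop where
  ge : ∀ x ∈ M, ∀ z, VGe v x z → VGe v (T x) (z + E * c)
  eq : ∀ x ∈ M, ∀ z, VEq v x (E * z) → ¬ (p : ℤ) ∣ z → VEq v (T x) (E * (z + c))

/-- Properties of a layer of the tower. -/
structure Layer (v : L → WithTop ℤ) (κ : k →+* L) (p : ℕ) (D : L → L)
    (M : IntermediateField K L) (E d : ℤ) : Prop where
  pos : 0 < E
  val : ∀ x ∈ M, x ≠ 0 → ∃ z, VEq v x (E * z)
  unif : ∃ s ∈ M, VEq v s E
  res : ∀ x ∈ M, VEq v x 0 → ∃ c : k, VGe v (x - κ c) 1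
  der : OpGood v p M E D (-d)

variable {v : L → WithTop ℤ} {κ : k →+* L} {p : ℕ}

/-- Dominant term of a combination of powers of `w`. -/
lemma lead_core (hv : IsNormVal v) [hp : Fact p.Prime] {M : IntermediateField K L} {E E' : ℤ}
    (hE' : 0 < E') (hE : E = p * E') (hval : ∀ x ∈ M, x ≠ 0 → ∃ z, VEq v x (E * z))
    {w : L} {R : ℤ} (hw : VEq v w (-(E' * R))) (hR : ¬ (p : ℤ) ∣ R)
    (c : ℕ → L) (hc : ∀ i, c i ∈ M) (hne : ∃ i < p, c i ≠ 0) :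
    ∃ i₀ < p, ∃ q : ℤ, c i₀ ≠ 0 ∧ VEq v (c i₀) (E * q) ∧
        VEq v (c i₀ * w ^ i₀) (E' * (p * q - i₀ * R)) ∧
        VEq v (∑ i ∈ Finset.range p, c i * w ^ i) (E' * (p * q - i₀ * R)) ∧
        ∀ i < p, i ≠ i₀ → VGe v (c i * w ^ i) (E' * (p * q - i₀ * R) + 1) := by
  have hw0 := hw.ne_zero hv
  have hval' : ∀ i, c i ≠ 0 → ∃ q, VEq v (c i) (E * q) ∧
      VEq v (c i * w ^ i) (E' * (p * q - i * R)) := by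
    intro i hi
    obtain ⟨q, hq⟩ := hval _ (hc i) hi
    refine ⟨q, hq, ?_⟩
    convert hq.mul hv (hw.pow hv i) using 1
    rw [hE]; ring
  have hterm : ∀ i, c i * w ^ i ≠ 0 → c i ≠ 0 := fun i h => left_ne_zero_of_mul h
  obtain ⟨i₀, hi₀, z, hz, hdom⟩ := exists_dominant hv (Finset.range p) (fun i => c i * w ^ i)
    (by
      obtain ⟨i, hi, hi'⟩ := hne
      exact ⟨i, Finset.mem_range.2 hi, mul_ne_zero hi' (pow_ne_zero _ hw0)⟩)
    (by
      intro i hi j hj z hzi hzj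
      rw [Finset.mem_range] at hi hj
      obtain ⟨q, -, h1⟩ := hval' i (hterm i (hzi.ne_zero hv))
      obtain ⟨q', -, h2⟩ := hval' j (hterm j (hzj.ne_zero hv))
      have h3 := h1.unique hzi
      have h4 := h2.unique hzj
      rw [← h4] at h3
      have h5 := mul_left_cancel₀ hE'.ne' h3
      have h6 : (p : ℤ) ∣ ((i : ℤ) - j) * R := ⟨q - q', by linarith⟩
      have hpp : Prime (p : ℤ) := Nat.prime_iff_prime_int.1 hp.out
      have h7 := (hpp.dvd_or_dvd h6).resolve_right hR
      have := Int.emod_emod_of_dvd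
      have h8 : (i : ℤ) % p = j % p := Int.emod_eq_emod_iff_emod_sub_eq_zero.2
        (Int.emod_eq_zero_of_dvd h7)
      rw [Int.emod_eq_of_lt (by positivity) (by exact_mod_cast hi),
        Int.emod_eq_of_lt (by positivity) (by exact_mod_cast hj)] at h8
      exact_mod_cast h8)
  obtain ⟨q, hq, h1⟩ := hval' i₀ (hterm _ (hz.ne_zero hv))
  have hzz := hz.unique h1
  subst hzz
  refine ⟨i₀, Finset.mem_range.1 hi₀, q, hterm _ (hz.ne_zero hv), hq, h1, ?_, ?_⟩
  · exact veq_sum_of hv _ _ i₀ hi₀ hz hdom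
  · intro i hi hne; exact hdom i (Finset.mem_range.2 hi) hne

/-- Decomposition with a dominant term. -/
lemma lead_term (hv : IsNormVal v) [hp : Fact p.Prime] {M M' : IntermediateField K L} {E E' : ℤ}
    (hE' : 0 < E') (hE : E = p * E') (hval : ∀ x ∈ M, x ≠ 0 → ∃ z, VEq v x (E * z))
    {w : L} {R : ℤ} (hw : VEq v w (-(E' * R))) (hR : ¬ (p : ℤ) ∣ R)
    (hdec : ∀ x ∈ M', ∃ c : ℕ → L, (∀ i, c i ∈ M) ∧ x = ∑ i ∈ Finset.range p, c i * w ^ i)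
    {x : L} (hx : x ∈ M') (hx0 : x ≠ 0) :
    ∃ c : ℕ → L, (∀ i, c i ∈ M) ∧ x = ∑ i ∈ Finset.range p, c i * w ^ i ∧
      ∃ i₀ < p, ∃ q : ℤ, c i₀ ≠ 0 ∧ VEq v (c i₀) (E * q) ∧
        VEq v (c i₀ * w ^ i₀) (E' * (p * q - i₀ * R)) ∧
        VEq v x (E' * (p * q - i₀ * R)) ∧
        ∀ i < p, i ≠ i₀ → VGe v (c i * w ^ i) (E' * (p * q - i₀ * R) + 1) := by
  obtain ⟨c, hc, hxc⟩ := hdec x hx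
  obtain ⟨i₀, h1, q, h2, h3, h4, h5, h6⟩ := lead_core hv hE' hE hval hw hR c hc (by
      by_contra hcon
      push Not at hcon
      exact hx0 (hxc.trans (Finset.sum_eq_zero fun i hi => by
        rw [hcon i (Finset.mem_range.1 hi), zero_mul])))
  rw [← hxc] at h5
  exact ⟨c, hc, hxc, i₀, h1, q, h2, h3, h4, h5, h6⟩

lemma op_step (hv : IsNormVal v) [hp : Fact p.Prime] {M M' : IntermediateField K L} {E E' : ℤ}
    (hE' : 0 < E') (hE : E = p * E') (hval : ∀ x ∈ M, x ≠ 0 → ∃ z, VEq v x (E * z))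
    {w : L} {R : ℤ} (hw : VEq v w (-(E' * R))) (hR : ¬ (p : ℤ) ∣ R)
    (hdec : ∀ x ∈ M', ∃ c : ℕ → L, (∀ i, c i ∈ M) ∧ x = ∑ i ∈ Finset.range p, c i * w ^ i)
    (T : L →+ L) (γ : ℤ)
    (hT : ∀ c ∈ M, ∀ i < p, ∀ z, VGe v (c * w ^ i) z → VGe v (T (c * w ^ i)) (z + E' * γ))
    (hT' : ∀ c ∈ M, ∀ i < p, i ≠ 0 → ∀ z, VEq v (c * w ^ i) z →
      VEq v (T (c * w ^ i)) (z + E' * γ)) :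
    OpGood v p M' E' T γ := by
  constructor
  · intro x hx z hz
    by_cases hx0 : x = 0
    · rw [hx0, map_zero]; exact vge_zero hv _
    obtain ⟨c, hc, hxc, i₀, hi₀, q, hc0, hq, h1, h2, h3⟩ :=
      lead_term hv hE' hE hval hw hR hdec hx hx0
    rw [h2.ge_iff] at hz
    rw [hxc, map_sum]
    apply vge_sum hv
    intro i hi
    rw [Finset.mem_range] at hi
    apply hT _ (hc i) i hi
    by_cases hii : i = i₀
    · subst hii; exact h1.ge.mono hz
    · exact (h3 i hi hii).mono (by omega)
  · intro x hx z hz hpz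
    have hx0 := hz.ne_zero hv
    obtain ⟨c, hc, hxc, i₀, hi₀, q, hc0, hq, h1, h2, h3⟩ :=
      lead_term hv hE' hE hval hw hR hdec hx hx0
    have hzz : z = p * q - i₀ * R := mul_left_cancel₀ hE'.ne' (hz.unique h2)
    have hi0 : i₀ ≠ 0 := by
      rintro rfl
      apply hpz
      rw [hzz]; simp
    rw [hxc, map_sum]
    apply veq_sum_of hv _ _ i₀ (Finset.mem_range.2 hi₀)
    · have := hT' _ (hc i₀) i₀ hi₀ hi0 _ h1
      convert this using 1
      rw [hzz]; ring
    · intro i hi hii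
      rw [Finset.mem_range] at hi
      have := hT _ (hc i) i hi _ (h3 i hi hii)
      refine this.mono ?_
      rw [hzz]; linarith

/-- Behaviour of `σ - 1` in a step. -/
lemma sigma_step (hv : IsNormVal v) [hp : Fact p.Prime] [CharP L p] {M M' : IntermediateField K L}
    {E E' : ℤ}
    (hE' : 0 < E') (hE : E = p * E') (hval : ∀ x ∈ M, x ≠ 0 → ∃ z, VEq v x (E * z))
    {w : L} {R : ℤ} (hw : VEq v w (-(E' * R))) (hR : ¬ (p : ℤ) ∣ R)
    (hdec : ∀ x ∈ M', ∃ c : ℕ → L, (∀ i, c i ∈ M) ∧ x = ∑ i ∈ Finset.range p, c i * w ^ i)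
    (σ : L ≃ₐ[K] L) {γ : ℤ} (hγ : 0 < γ)
    (hσM : ∀ x ∈ M, ∀ z, VGe v x z → VGe v (σ x - x) (z + E' * γ + 1))
    (hσw : VEq v (σ w - w) (-(E' * R) + E' * γ)) :
    OpGood v p M' E' (fun x => σ x - x) γ := by
  have hEγ : 0 < E' * γ := by positivity
  have hσw' : VEq v (σ w) (-(E' * R)) := by
    have := hw.add_ge hv (hσw.ge.mono (by omega : -(E' * R) + 1 ≤ _))
    simpa using this
  have key : ∀ c ∈ M, ∀ i, ∀ z, VGe v (c * w ^ i) z →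
      VGe v ((σ c - c) * σ w ^ i) (z + E' * γ + 1) := by
    intro c hc i z hz
    by_cases hc0 : c = 0
    · simpa [hc0] using vge_zero hv _
    obtain ⟨q, hq⟩ := hval c hc hc0
    have h1 := hq.mul hv (hw.pow hv i)
    rw [h1.ge_iff] at hz
    refine ((hσM c hc _ hq.ge).mul hv (hσw'.ge.pow hv i)).mono ?_
    linarith
  have expand : ∀ c : L, ∀ i : ℕ, σ (c * w ^ i) - c * w ^ i =
      c * (σ w ^ i - w ^ i) + (σ c - c) * σ w ^ i := by
    intro c i; rw [map_mul, map_pow]; ring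
  refine op_step hv hE' hE hval hw hR hdec
    (AddMonoidHom.mk' (fun x => σ x - x) (fun x y => by rw [map_add]; ring)) γ ?_ ?_
  · intro c hc i hi z hz
    change VGe v (σ (c * w ^ i) - c * w ^ i) _
    rw [expand]
    refine VGe.add hv ?_ ((key c hc i z hz).mono (by omega))
    by_cases hi0 : i = 0
    · subst hi0; simpa using vge_zero hv _
    by_cases hc0 : c = 0
    · simpa [hc0] using vge_zero hv _
    obtain ⟨q, hq⟩ := hval c hc hc0
    have h1 := hq.mul hv (hw.pow hv i)
    rw [h1.ge_iff] at hz
    have h2 := hq.mul hv (veq_pow_sub hv hEγ hw hσw i hi0 hi)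
    exact h2.ge.mono (by linarith)
  · intro c hc i hi hi0 z hz
    change VEq v (σ (c * w ^ i) - c * w ^ i) _
    rw [expand]
    refine VEq.add_ge hv ?_ ((key c hc i z hz.ge))
    obtain ⟨q, hq⟩ := hval c hc (left_ne_zero_of_mul (hz.ne_zero hv))
    have h1 := hq.mul hv (hw.pow hv i)
    have h2 := hq.mul hv (veq_pow_sub hv hEγ hw hσw i hi0 hi)
    rw [hz.unique h1]
    convert h2 using 1
    ring

/-- The new layer. -/
lemma layer_step (hv : IsNormVal v) [hp : Fact p.Prime] [CharP L p] {D : Derivation ℤ L L}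
    {M M' : IntermediateField K L} {E d : ℤ} (hM : Layer v κ p D M E d)
    {w β : L} {R : ℤ} (hβM : β ∈ M) (hβ : VEq v β (-(E * R))) (hR : ¬ (p : ℤ) ∣ R) (hR0 : 0 < R)
    (hwβ : w ^ p - w = β) (hMM' : M ≤ M') (hwM' : w ∈ M')
    (hdec : ∀ x ∈ M', ∃ c : ℕ → L, (∀ i, c i ∈ M) ∧ x = ∑ i ∈ Finset.range p, c i * w ^ i) :
    ∃ E' : ℤ, E = p * E' ∧ 0 < E' ∧ VEq v w (-(E' * R)) ∧
      Layer v κ p D M' E' (p * d + (p - 1) * R) := by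
  have hpp : Prime (p : ℤ) := Nat.prime_iff_prime_int.1 hp.out
  have hp2 : (2 : ℤ) ≤ p := by exact_mod_cast hp.out.two_le
  have hER : 0 < E * R := mul_pos hM.pos hR0
  obtain ⟨y, hy, hwy⟩ := as_veq hv hp.out.two_le hwβ hβ (by omega)
  have hdE : (p : ℤ) ∣ E := by
    have : (p : ℤ) ∣ E * R := ⟨-y, by linarith⟩
    exact (hpp.dvd_or_dvd this).resolve_right hR
  obtain ⟨E', hE⟩ := hdE
  have hE' : 0 < E' := by have := hM.pos; rw [hE] at this; exact pos_of_mul_pos_right this (by omega)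
  have hw : VEq v w (-(E' * R)) := by
    have : y = -(E' * R) := by
      apply mul_left_cancel₀ hpp.ne_zero
      rw [← hy, hE]; ring
    rwa [this] at hwy
  refine ⟨E', hE, hE', hw, hE', ?_, ?_, ?_, ?_⟩
  · intro x hx hx0
    obtain ⟨c, hc, hxc, i₀, hi₀, q, hc0, hq, h1, h2, h3⟩ :=
      lead_term hv hE' hE hM.val hw hR hdec hx hx0
    exact ⟨_, h2⟩
  · obtain ⟨s, hs, hsE⟩ := hM.unif
    have hcop : IsCoprime (p : ℤ) R := (Prime.coprime_iff_not_dvd hpp).2 hR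
    obtain ⟨a, b, hab⟩ := hcop
    refine ⟨s ^ a * w ^ (-b), mul_mem (zpow_mem (hMM' hs) _) (zpow_mem hwM' _), ?_⟩
    convert (hsE.zpow hv a).mul hv (hw.zpow hv (-b)) using 1
    rw [hE]
    linear_combination (-E') * hab
  · intro x hx hx0
    obtain ⟨c, hc, hxc, i₀, hi₀, q, hc0, hq, h1, h2, h3⟩ :=
      lead_term hv hE' hE hM.val hw hR hdec hx (hx0.ne_zero hv)
    have h4 : p * q - i₀ * R = 0 := by
      have := h2.unique hx0
      rcases mul_eq_zero.1 this with h | h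
      · omega
      · exact h
    have hi0 : i₀ = 0 := by
      have : (p : ℤ) ∣ i₀ * R := ⟨q, by linarith⟩
      have := (hpp.dvd_or_dvd this).resolve_right hR
      have := Int.natCast_dvd_natCast.1 this
      exact Nat.eq_zero_of_dvd_of_lt this hi₀
    subst hi0
    have hq0 : q = 0 := by
      simp only [Nat.cast_zero, zero_mul, sub_zero] at h4
      rcases mul_eq_zero.1 h4 with h | h
      · omega
      · exact h
    subst hq0
    rw [mul_zero] at hq
    obtain ⟨c', hc'⟩ := hM.res _ (hc 0) hq
    refine ⟨c', ?_⟩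
    have e : x - κ c' = (x - c 0) + (c 0 - κ c') := by ring
    rw [e]
    refine VGe.add hv ?_ hc'
    have hxx : x - c 0 = ∑ i ∈ (Finset.range p).erase 0, c i * w ^ i := by
      rw [hxc, ← Finset.add_sum_erase _ _ (Finset.mem_range.2 hi₀)]
      simp
    rw [hxx]
    apply vge_sum hv
    intro i hi
    rw [Finset.mem_erase, Finset.mem_range] at hi
    refine (h3 i hi.2 hi.1).mono ?_
    simp
  · have hDw : D w = - D β := by
      rw [← hwβ, map_sub, Derivation.leibniz_pow]
      simp
    have hDwv : VEq v (D w) (-(E' * R) + E' * (-(p * d + (p - 1) * R))) := by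
      rw [hDw]
      have := (hM.der.eq β hβM (-R) (by rw [mul_neg]; exact hβ)
        (by rwa [dvd_neg])).neg hv
      convert this using 1
      rw [hE]; ring
    have hgap : (E' * (-(p * d + (p - 1) * R))) + 1 ≤ E * (-d) := by
      have : 0 < E' * ((p - 1) * R) := by
        apply mul_pos hE' (mul_pos (by omega) hR0)
      rw [hE]; linarith
    have expand : ∀ (c : L) (i : ℕ), D (c * w ^ i) = c * (i * w ^ (i - 1) * D w) + w ^ i * D c := by
      intro c i
      rw [Derivation.leibniz, Derivation.leibniz_pow]
      simp only [smul_eq_mul, nsmul_eq_mul]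
      ring
    have hnat : ∀ i : ℕ, i ≠ 0 → i < p → VEq v (i : L) 0 := by
      intro i h0 hi
      have h1 : VEq v (1 : L) 0 := veq_one hv
      have hne : (i : L) ≠ 0 := by
        intro h
        rw [CharP.cast_eq_zero_iff L p] at h
        exact absurd (Nat.le_of_dvd (by omega) h) (by omega)
      obtain ⟨z, hz⟩ := exists_veq hv hne
      have hfr : (i : L) ^ p = i := by
        have hz := ZMod.pow_card (p := p) (i : ZMod p)
        have h2 : ((i ^ p : ℕ) : ZMod p) = (i : ℕ) := by push_cast; exact hz
        have h3 := (ZMod.natCast_eq_natCast_iff _ _ _).1 h2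
        rw [← Nat.cast_pow]
        exact (CharP.natCast_eq_natCast L p).2 h3
      have h1 := hz.pow hv p
      rw [hfr] at h1
      have h2 := hz.unique h1
      have : z = 0 := by
        have : (p - 1 : ℤ) * z = 0 := by linarith
        rcases mul_eq_zero.1 this with h | h
        · omega
        · exact h
      rwa [this] at hz
    have hD1 : ∀ c : L, ∀ i < p, i ≠ 0 → ∀ z, VEq v (c * w ^ i) z →
        VEq v (c * (i * w ^ (i - 1) * D w)) (z + E' * (-(p * d + (p - 1) * R))) := by
      intro c i hi hi0 z hz
      obtain ⟨y, hy⟩ := exists_veq hv (left_ne_zero_of_mul (hz.ne_zero hv))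
      have h1 := hy.mul hv (((hnat i hi0 hi).mul hv (hw.pow hv (i - 1))).mul hv hDwv)
      rw [hz.unique (hy.mul hv (hw.pow hv i))]
      convert h1 using 1
      obtain ⟨j, rfl⟩ := Nat.exists_eq_succ_of_ne_zero hi0
      push_cast; simp; ring
    have hD2 : ∀ c ∈ M, ∀ i, ∀ z, VGe v (c * w ^ i) z →
        VGe v (w ^ i * D c) (z + E' * (-(p * d + (p - 1) * R)) + 1) := by
      intro c hc i z hz
      by_cases hc0 : c = 0
      · simpa [hc0] using vge_zero hv _
      obtain ⟨y, hy⟩ := exists_veq hv hc0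
      have h1 := (hw.pow hv i).ge.mul hv (hM.der.ge c hc y hy.ge)
      rw [(hy.mul hv (hw.pow hv i)).ge_iff] at hz
      exact h1.mono (by linarith)
    refine op_step hv hE' hE hM.val hw hR hdec (D : L →ₗ[ℤ] L).toAddMonoidHom _ ?_ ?_
    · intro c hc i hi z hz
      change VGe v (D (c * w ^ i)) _
      rw [expand]
      refine VGe.add hv ?_ ((hD2 c hc i z hz).mono (by omega))
      by_cases hi0 : i = 0
      · subst hi0; simpa using vge_zero hv _
      by_cases hc0 : c = 0
      · simpa [hc0] using vge_zero hv _
      obtain ⟨y, hy⟩ := exists_veq hv (mul_ne_zero hc0 (pow_ne_zero i (hw.ne_zero hv)))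
      rw [hy.ge_iff] at hz
      exact (hD1 c i hi hi0 y hy).ge.mono (by linarith)
    · intro c hc i hi hi0 z hz
      change VEq v (D (c * w ^ i)) _
      rw [expand]
      exact (hD1 c i hi hi0 z hz).add_ge hv (hD2 c hc i z hz.ge)

end Layer
end S15

namespace S15

section BaseLayer
variable {k K L : Type*} [Field k] [Field K] [Field L] [Algebra K L]
variable {v : L → WithTop ℤ} {p : ℕ}

lemma kap_mem (ι : K ≃+* LaurentSeries k) (M : IntermediateField K L) (c : k) :
    kap ι L c ∈ M := M.algebraMap_mem _

lemma base_layer [CharP k p] (ι : K ≃+* LaurentSeries k) (hv : IsNormVal v) {e : ℕ}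
    (he : ExtendsWithE (lfVal ι) v e) (he0 : 0 < e)
    (D : Derivation ℤ L L) (hD : ∀ x, D (algebraMap K L x) = algebraMap K L (eulerDer ι x)) :
    Layer v (kap ι L) p D (⊥ : IntermediateField K L) e 0 := by
  refine ⟨by exact_mod_cast he0, ?_, ?_, ?_, ?_, ?_⟩
  · intro x hx hx0
    obtain ⟨y, rfl⟩ := IntermediateField.mem_bot.1 hx
    have : y ≠ 0 := by rintro rfl; simp at hx0
    exact ⟨_, base_veq ι he this⟩
  · refine ⟨algebraMap K L (ι.symm (HahnSeries.single 1 1)), IntermediateField.algebraMap_mem _ _, ?_⟩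
    have := base_veq ι he (x := ι.symm (HahnSeries.single 1 1)) (by simp)
    simpa using this
  · intro x hx hx0
    obtain ⟨y, rfl⟩ := IntermediateField.mem_bot.1 hx
    have hy : y ≠ 0 := by rintro rfl; exact hx0.ne_zero hv (map_zero _)
    have h1 := (base_veq ι he hy).unique hx0
    have h2 : (ι y).order = 0 := by
      rcases mul_eq_zero.1 h1 with h | h
      · exact absurd h (by exact_mod_cast he0.ne')
      · exact h
    refine ⟨(ι y).coeff 0, ?_⟩
    have : algebraMap K L y - kap ι L ((ι y).coeff 0) =
        algebraMap K L (y - ι.symm (HahnSeries.C ((ι y).coeff 0))) := by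
      simp [kap]
    rw [this]
    refine VGe.mono (base_vge ι hv he (z := 1) ?_) (by
      have : (1 : ℤ) ≤ e := by exact_mod_cast he0
      omega)
    intro n hn
    simp only [map_sub, RingEquiv.apply_symm_apply, HahnSeries.coeff_sub]
    rcases lt_or_eq_of_le (show n ≤ 0 by omega) with h | h
    · rw [HahnSeries.coeff_eq_zero_of_lt_order (by rw [h2]; exact h)]
      simp [HahnSeries.C_apply, HahnSeries.coeff_single_of_ne h.ne]
    · subst h; simp [HahnSeries.C_apply]
  · intro x hx z hz
    obtain ⟨y, rfl⟩ := IntermediateField.mem_bot.1 hx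
    by_cases hy : y = 0
    · subst hy; simpa using vge_zero hv _
    rw [hD]
    rw [(base_veq ι he hy).ge_iff] at hz
    refine (base_vge ι hv he (z := (ι y).order) ?_).mono (by simpa using hz)
    intro n hn
    rw [eulerDer_apply, eulerFun_coeff, HahnSeries.coeff_eq_zero_of_lt_order hn, mul_zero]
  · intro x hx z hz hpz
    obtain ⟨y, rfl⟩ := IntermediateField.mem_bot.1 hx
    have hy : y ≠ 0 := by rintro rfl; exact hz.ne_zero hv (map_zero _)
    have he' : (e : ℤ) ≠ 0 := by exact_mod_cast he0.ne'
    have h1 : (ι y).order = z := mul_left_cancel₀ he' ((base_veq ι he hy).unique hz)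
    have hιy : ι y ≠ 0 := by simpa using hy
    have hc : (ι (eulerDer ι y)).coeff z ≠ 0 := by
      rw [eulerDer_apply, eulerFun_coeff]
      refine mul_ne_zero ?_ ?_
      · rwa [Ne, CharP.intCast_eq_zero_iff k p]
      · rw [← h1]; exact fun h => hιy (HahnSeries.coeff_order_eq_zero.1 h)
    have hne : ι (eulerDer ι y) ≠ 0 := by
      intro h; rw [h] at hc; simp at hc
    have h2 : (ι (eulerDer ι y)).order = z := by
      apply le_antisymm
      · exact HahnSeries.order_le_of_coeff_ne_zero hc
      · refine (HahnSeries.le_order_iff_forall hne).2 ?_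
        intro n hn
        rw [eulerDer_apply, eulerFun_coeff, HahnSeries.coeff_eq_zero_of_lt_order (by omega),
          mul_zero]
    rw [hD]
    have := base_veq ι he (x := eulerDer ι y) (by rintro h; rw [h] at hne; simp at hne)
    rw [h2] at this
    simpa using this

/-- Reduction of an element of `M` modulo `z ^ p - z`. -/
lemma reduction [hp : Fact p.Prime] [CharP L p] [CharP k p] [PerfectField k] {κ : k →+* L}
    (hv : IsNormVal v) {D : L → L}
    {M : IntermediateField K L} {E d : ℤ} (hM : Layer v κ p D M E d) (hκ : ∀ c, κ c ∈ M) :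
    ∀ (B : ℕ) (β : L), β ∈ M → VGe v β (-(B : ℤ)) →
    ∃ z ∈ M, (∃ g, VGe v z g ∧ -(B : ℤ) ≤ p * g) ∧
      (VGe v (β + z ^ p - z) 0 ∨ ∃ q, ¬ (p : ℤ) ∣ q ∧ VEq v (β + z ^ p - z) (E * q)) := by
  have hp2 : (2 : ℤ) ≤ p := by exact_mod_cast hp.out.two_le
  have hp0 : p ≠ 0 := hp.out.ne_zero
  intro B
  induction B using Nat.strong_induction_on with
  | _ B ih =>
  intro β hβM hβ
  have triv : (VGe v β 0 ∨ ∃ q, ¬ (p : ℤ) ∣ q ∧ VEq v β (E * q)) → ∃ z ∈ M,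
      (∃ g, VGe v z g ∧ -(B : ℤ) ≤ p * g) ∧
      (VGe v (β + z ^ p - z) 0 ∨ ∃ q, ¬ (p : ℤ) ∣ q ∧ VEq v (β + z ^ p - z) (E * q)) := by
    intro h
    refine ⟨0, zero_mem _, ⟨0, vge_zero hv _, by simp⟩, ?_⟩
    simpa [zero_pow hp0] using h
  by_cases h0 : VGe v β 0
  · exact triv (Or.inl h0)
  have hβ0 : β ≠ 0 := by rintro rfl; exact h0 (vge_zero hv _)
  obtain ⟨q, hq⟩ := hM.val β hβM hβ0
  by_cases hpq : (p : ℤ) ∣ q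
  swap
  · exact triv (Or.inr ⟨q, hpq, hq⟩)
  obtain ⟨q', rfl⟩ := hpq
  rw [hq.ge_iff] at h0 hβ
  push Not at h0
  obtain ⟨s, hsM, hs⟩ := hM.unif
  have hEpos := hM.pos
  have hq' : E * q' < 0 := by
    by_contra hcon
    push Not at hcon
    have : 0 ≤ (p : ℤ) * (E * q') := by positivity
    linarith
  have hgap : E * (p * q') + 1 ≤ E * q' := by nlinarith
  set u := β * s ^ (-(p * q') : ℤ) with hu
  have hs0 := hs.ne_zero hv
  have huM : u ∈ M := mul_mem hβM (zpow_mem hsM _)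
  have hu0 : VEq v u 0 := by
    convert hq.mul hv (hs.zpow hv (-(p * q'))) using 1
    ring
  obtain ⟨c, hc⟩ := hM.res u huM hu0
  haveI : PerfectRing k p := PerfectField.toPerfectRing p
  obtain ⟨c0, hc0⟩ := (bijective_frobenius k p).2 (-c)
  rw [frobenius_def] at hc0
  set z0 := κ c0 * s ^ q' with hz0
  have hz0M : z0 ∈ M := mul_mem (hκ _) (zpow_mem hsM _)
  have hz0p : z0 ^ p = - (κ c * s ^ ((p : ℤ) * q')) := by
    rw [hz0, mul_pow, ← map_pow, hc0, map_neg, neg_mul, ← zpow_natCast, ← zpow_mul, mul_comm q']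
  have hβu : β = u * s ^ ((p : ℤ) * q') := by
    rw [hu, mul_assoc, ← zpow_add₀ hs0]; simp
  have hκ0 : VGe v (κ c0) 0 := by
    have h1 : VGe v (κ c) 0 := by
      have := hu0.ge.sub hv (hc.mono (zero_le_one))
      simpa using this
    have h2 : VGe v (κ c0 ^ p) 0 := by
      rw [← map_pow, hc0, map_neg]; exact h1.neg hv
    by_cases h : κ c0 = 0
    · rw [h]; exact vge_zero hv _
    obtain ⟨y, hy⟩ := exists_veq hv h
    rw [(hy.pow hv p).ge_iff] at h2
    rw [hy.ge_iff]
    by_contra hcon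
    push Not at hcon
    nlinarith
  have hz0v : VGe v z0 (E * q') := by
    refine (hκ0.mul hv (hs.zpow hv q').ge).mono ?_
    linarith
  have h1 : VGe v (β + z0 ^ p - z0) (E * (p * q') + 1) := by
    refine VGe.sub hv ?_ (hz0v.mono hgap)
    have : β + z0 ^ p = (u - κ c) * s ^ ((p : ℤ) * q') := by rw [hz0p, hβu]; ring
    rw [this]
    refine (hc.mul hv (hs.zpow hv _).ge).mono ?_
    linarith
  obtain ⟨B', hB'⟩ : ∃ B' : ℕ, (B' : ℤ) = -(E * (p * q') + 1) :=
    ⟨(-(E * (p * q') + 1)).toNat, by rw [Int.toNat_of_nonneg]; omega⟩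
  obtain ⟨z1, hz1M, ⟨g, hg, hg'⟩, hz1⟩ := ih B' (by omega) (β + z0 ^ p - z0)
    (sub_mem (add_mem hβM (pow_mem hz0M _)) hz0M) (by rw [hB', neg_neg]; exact h1)
  have hB2 : -(B : ℤ) ≤ p * g := by omega
  refine ⟨z0 + z1, add_mem hz0M hz1M, ⟨min (E * q') g, ?_, ?_⟩, ?_⟩
  · exact (hz0v.mono (min_le_left _ _)).add hv (hg.mono (min_le_right _ _))
  · rcases min_cases (E * q') g with ⟨h, -⟩ | ⟨h, -⟩ <;> rw [h]
    · calc -(B : ℤ) ≤ E * (p * q') := hβ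
        _ = _ := by ring
    · exact hB2
  · have : β + (z0 + z1) ^ p - (z0 + z1) = β + z0 ^ p - z0 + z1 ^ p - z1 := by
      rw [add_pow_char]; ring
    rw [this]; exact hz1

end BaseLayer
end S15

namespace S15

section Simple
variable {K L : Type*} [Field K] [Field L] [Algebra K L]
variable {v : L → WithTop ℤ} {p : ℕ}
open Polynomial IntermediateField

lemma dec_simple [hp : Fact p.Prime] (M : IntermediateField K L) {w β : L} (hβ : β ∈ M)
    (hw : w ^ p - w = β) :
    ∀ x ∈ (IntermediateField.adjoin M {w}).restrictScalars K, ∃ c : ℕ → L, (∀ i, c i ∈ M) ∧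
      x = ∑ i ∈ Finset.range p, c i * w ^ i := by
  intro x hx
  set P : M[X] := X ^ p - X - C ⟨β, hβ⟩ with hP
  have hPw : aeval w P = 0 := by
    simp [hP, hw]
  have h2 : 2 ≤ p := hp.out.two_le
  have hP' : P = X ^ p - (X + C ⟨β, hβ⟩) := by rw [hP]; ring
  have hdeg : (X + C (⟨β, hβ⟩ : M)).degree < (p : WithBot ℕ) := by
    rw [degree_X_add_C]; exact_mod_cast h2
  have hmon : P.Monic := by
    rw [hP']; exact monic_X_pow_sub (by
      rw [degree_X_add_C]; exact_mod_cast h2)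
  have hnd : P.natDegree = p := by
    rw [hP']
    apply natDegree_eq_of_degree_eq_some
    rw [degree_sub_eq_left_of_degree_lt (by rw [degree_X_pow]; exact hdeg), degree_X_pow]
  have halg : IsAlgebraic M w := ⟨P, hmon.ne_zero, hPw⟩
  have hx' : x ∈ (IntermediateField.adjoin M {w}).toSubalgebra := hx
  rw [IntermediateField.adjoin_simple_toSubalgebra_of_isAlgebraic halg,
    Algebra.adjoin_singleton_eq_range_aeval] at hx'
  obtain ⟨f, rfl⟩ := hx'
  refine ⟨fun i => ((f %ₘ P).coeff i : L), fun i => SetLike.coe_mem _, ?_⟩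
  have h3 : (f %ₘ P).natDegree < p := by
    rw [← hnd]
    apply natDegree_modByMonic_lt _ hmon
    intro h; rw [h, natDegree_one] at hnd; omega
  change aeval w f = _
  rw [← aeval_modByMonic_eq_self_of_root hPw, aeval_eq_sum_range' h3]
  rfl

lemma finrank_simple [FiniteDimensional K L] (hv : IsNormVal v) [hp : Fact p.Prime]
    {M : IntermediateField K L} {E E' : ℤ}
    (hE' : 0 < E') (hE : E = p * E') (hval : ∀ x ∈ M, x ≠ 0 → ∃ z, VEq v x (E * z))
    {w : L} {R : ℤ} (hw : VEq v w (-(E' * R))) (hR : ¬ (p : ℤ) ∣ R)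
    {β : L} (hβ : β ∈ M) (hwβ : w ^ p - w = β) :
    Module.finrank M L =
      p * Module.finrank ((IntermediateField.adjoin M {w}).restrictScalars K) L := by
  have hIgr : IsIntegral M w := Algebra.IsIntegral.isIntegral w
  have h1 : Module.finrank M (IntermediateField.adjoin M {w}) = p := by
    rw [IntermediateField.adjoin.finrank hIgr]
    set P : M[X] := X ^ p - X - C ⟨β, hβ⟩ with hP
    have hPw : aeval w P = 0 := by
      simp [hP, hwβ]
    have h2 : 2 ≤ p := hp.out.two_le
    have hP' : P = X ^ p - (X + C ⟨β, hβ⟩) := by rw [hP]; ring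
    have hdeg : (X + C (⟨β, hβ⟩ : M)).degree < (p : WithBot ℕ) := by
      rw [degree_X_add_C]; exact_mod_cast h2
    have hmon : P.Monic := by
      rw [hP']; exact monic_X_pow_sub (by
        rw [degree_X_add_C]; exact_mod_cast h2)
    have hnd : P.natDegree = p := by
      rw [hP']
      apply natDegree_eq_of_degree_eq_some
      rw [degree_sub_eq_left_of_degree_lt (by rw [degree_X_pow]; exact hdeg), degree_X_pow]
    apply le_antisymm
    · rw [← hnd]
      exact natDegree_le_of_dvd (minpoly.dvd _ _ hPw) hmon.ne_zero
    · by_contra hcon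
      push Not at hcon
      have h3 := aeval_eq_sum_range' hcon w
      rw [minpoly.aeval] at h3
      obtain ⟨i₀, _, q, _, _, _, h5, _⟩ := lead_core hv hE' hE hval hw hR
        (fun i => ((minpoly M w).coeff i : L)) (fun i => SetLike.coe_mem _)
        ⟨(minpoly M w).natDegree, hcon, by
          have := minpoly.monic hIgr
          rw [Monic, leadingCoeff] at this
          simp [this]⟩
      exact h5.ne_zero hv h3.symm
  rw [← h1]
  exact (Module.finrank_mul_finrank M (IntermediateField.adjoin M {w}) L).symm

end Simple
end S15

namespace S15

section Witt
open MvPolynomial WittVector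
variable (p : ℕ) [hp : Fact p.Prime]

/-- The ghost equation for addition. -/
lemma ghost (n : ℕ) : ∑ i ∈ Finset.range (n + 1), (p : MvPolynomial (Fin 2 × ℕ) ℤ) ^ i *
      wittAdd p i ^ p ^ (n - i) =
    (∑ i ∈ Finset.range (n + 1), (p : MvPolynomial (Fin 2 × ℕ) ℤ) ^ i * X (0, i) ^ p ^ (n - i)) +
    ∑ i ∈ Finset.range (n + 1), (p : MvPolynomial (Fin 2 × ℕ) ℤ) ^ i * X (1, i) ^ p ^ (n - i) := by
  have h := wittStructureInt_prop p (X 0 + X 1 : MvPolynomial (Fin 2) ℤ) n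
  have h1 : bind₁ (wittStructureInt p (X 0 + X 1 : MvPolynomial (Fin 2) ℤ)) (wittPolynomial p ℤ n)
    = ∑ i ∈ Finset.range (n + 1), (p : MvPolynomial (Fin 2 × ℕ) ℤ) ^ i *
      wittAdd p i ^ p ^ (n - i) := aeval_wittPolynomial p ℤ _ _
  rw [← h1, h, map_add, bind₁_X_right, bind₁_X_right]
  simp [wittPolynomial_eq_sum_C_mul_X_pow]

/-- the non linear part of the addition polynomial -/
def wq (n : ℕ) : MvPolynomial (Fin 2 × ℕ) ℤ := wittAdd p n - X (0, n) - X (1, n)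

lemma wq_eq (n : ℕ) : C ((p : ℤ) ^ n) * wq p n = ∑ i ∈ Finset.range n, C ((p : ℤ) ^ i) *
    (X (0, i) ^ p ^ (n - i) + X (1, i) ^ p ^ (n - i) - wittAdd p i ^ p ^ (n - i)) := by
  have h := ghost p n
  simp only [Finset.sum_range_succ, Nat.sub_self, pow_zero, pow_one] at h
  simp only [mul_add, mul_sub, Finset.sum_add_distrib, Finset.sum_sub_distrib, wq, map_pow,
    map_natCast]
  linear_combination h

lemma wq_vars (n : ℕ) : ∀ s ∈ (wq p n).vars, s.2 < n := by
  have hpn : ((p : ℤ) ^ n) ≠ 0 := pow_ne_zero _ (by exact_mod_cast hp.out.ne_zero)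
  rw [← vars_C_mul _ hpn, wq_eq]
  intro s hs
  have := vars_sum_subset _ _ hs
  rw [Finset.mem_biUnion] at this
  obtain ⟨i, hi, h⟩ := this
  rw [Finset.mem_range] at hi
  rw [vars_C_mul _ (pow_ne_zero _ (by exact_mod_cast hp.out.ne_zero))] at h
  have h1 : s.2 ≤ i := by
    rcases Finset.mem_union.1 (vars_sub_subset _ h) with h | h
    · rcases Finset.mem_union.1 (vars_add_subset _ _ h) with h | h
      · have := vars_pow _ _ h
        rw [vars_X, Finset.mem_singleton] at this
        rw [this]
      · have := vars_pow _ _ h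
        rw [vars_X, Finset.mem_singleton] at this
        rw [this]
    · have := wittAdd_vars p i (vars_pow _ _ h)
      rw [Finset.mem_product, Finset.mem_range] at this
      omega
  omega

lemma wq_hom (n : ℕ) : IsWeightedHomogeneous (fun s : Fin 2 × ℕ => p ^ s.2) (wq p n) (p ^ n) := by
  induction n using Nat.strong_induction_on with
  | _ n ih =>
  have hX : ∀ (b : Fin 2) (i : ℕ), IsWeightedHomogeneous (fun s : Fin 2 × ℕ => p ^ s.2)
      (X (b, i) : MvPolynomial (Fin 2 × ℕ) ℤ) (p ^ i) := fun b i => isWeightedHomogeneous_X _ _ _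
  have hS : ∀ i < n, IsWeightedHomogeneous (fun s : Fin 2 × ℕ => p ^ s.2)
      (wittAdd p i) (p ^ i) := by
    intro i hi
    have : wittAdd p i = wq p i + X (0, i) + X (1, i) := by rw [wq]; ring
    rw [this]
    exact ((ih i hi).add (hX 0 i)).add (hX 1 i)
  have h : IsWeightedHomogeneous (fun s : Fin 2 × ℕ => p ^ s.2) (C ((p : ℤ) ^ n) * wq p n)
      (p ^ n) := by
    rw [wq_eq]
    apply IsWeightedHomogeneous.sum
    intro i hi
    rw [Finset.mem_range] at hi
    apply IsWeightedHomogeneous.C_mul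
    have e : p ^ n = p ^ (n - i) • p ^ i := by
      rw [smul_eq_mul, ← pow_add]; congr 1; omega
    rw [e]
    exact (((hX 0 i).pow _).add ((hX 1 i).pow _)).sub ((hS i hi).pow _)
  intro d hd
  apply h
  rw [coeff_C_mul]
  exact mul_ne_zero (pow_ne_zero _ (by exact_mod_cast hp.out.ne_zero)) hd

/-- Valuation of a weighted homogeneous expression. -/
lemma wq_vge {L : Type*} [Field L] {v : L → WithTop ℤ} (hv : IsNormVal v) (n : ℕ)
    (y : Fin 2 × ℕ → L) (C : ℤ)
    (hy : ∀ s, s.2 < n → ∃ g, VGe v (y s) g ∧ -(C * p ^ s.2) ≤ g * p ^ n) :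
    VGe v (aeval y (wq p n)) (-C) := by
  rw [aeval_def, eval₂_eq]
  apply vge_sum hv
  intro d hd
  have hIgr : ∀ z : ℤ, VGe v (algebraMap ℤ L z) 0 := by
    intro z
    have hnat : ∀ m : ℕ, VGe v (m : L) 0 := by
      intro m
      induction m with
      | zero => simpa using vge_zero hv _
      | succ m ih => push_cast; exact ih.add hv (veq_one hv).ge
    rcases Int.eq_nat_or_neg z with ⟨m, rfl | rfl⟩
    · simpa using hnat m
    · simpa using (hnat m).neg hv
  have hvars : ∀ s ∈ d.support, s.2 < n := fun s hs => wq_vars p n s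
    ((mem_vars_iff_mem_support s).2 ⟨d, hd, hs⟩)
  choose! g hg hg' using fun s (hs : s ∈ d.support) => hy s (hvars s hs)
  have hhom := wq_hom p n (mem_support_iff.1 hd)
  have h1 := vge_prod hv d.support (fun s => y s ^ d s) (fun s => d s * g s)
    (fun s hs => (hg s hs).pow hv _)
  refine ((hIgr _).mul hv h1).mono ?_
  have hpn : (0 : ℤ) < p ^ n := pow_pos (by exact_mod_cast hp.out.pos) _
  rw [zero_add]
  refine le_of_mul_le_mul_right ?_ hpn
  rw [Finset.sum_mul]
  have h2 : ((p ^ n : ℕ) : ℤ) = ∑ s ∈ d.support, (d s : ℤ) * p ^ s.2 := by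
    rw [← hhom, Finsupp.weight_apply, Finsupp.sum]
    push_cast; simp
  push_cast at h2
  nth_rw 1 [h2]
  rw [Finset.mul_sum]
  apply Finset.sum_le_sum
  intro s hs
  have := mul_le_mul_of_nonneg_left (hg' s hs) (show (0 : ℤ) ≤ d s by positivity)
  linarith

lemma wq_mem {K L : Type*} [Field K] [Field L] [Algebra K L] (M : IntermediateField K L) (n : ℕ)
    (y : Fin 2 × ℕ → L) (hy : ∀ s, s.2 < n → y s ∈ M) : aeval y (wq p n) ∈ M := by
  rw [aeval_def, eval₂_eq]
  apply sum_mem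
  intro d hd
  refine mul_mem ?_ (prod_mem fun s hs => pow_mem (hy s (wq_vars p n s
    ((mem_vars_iff_mem_support s).2 ⟨d, hd, hs⟩))) _)
  simp

lemma wittAdd_congr {R : Type*} [CommRing R] (n : ℕ) (y y' : Fin 2 × ℕ → R)
    (h : ∀ s, s.2 ≤ n → y s = y' s) : aeval y (wittAdd p n) = aeval y' (wittAdd p n) := by
  rw [aeval_def, eval₂_eq, aeval_def, eval₂_eq]
  refine Finset.sum_congr rfl fun d hd => ?_
  congr 1
  refine Finset.prod_congr rfl fun s hs => ?_
  rw [h]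
  have := wittAdd_vars p n ((mem_vars_iff_mem_support s).2 ⟨d, hd, hs⟩)
  rw [Finset.mem_product, Finset.mem_range] at this
  omega

lemma wittAdd_zero {R : Type*} [CommRing R] (n : ℕ) (y : Fin 2 × ℕ → R)
    (h : ∀ i ≤ n, y (1, i) = 0) : aeval y (wittAdd p n) = y (0, n) := by
  have := WittVector.add_coeff (p := p) (WittVector.mk p fun i => y (0, i)) 0 n
  rw [add_zero, WittVector.coeff_mk] at this
  rw [this, peval]
  apply wittAdd_congr
  rintro ⟨b, i⟩ hi
  fin_cases b
  · simp [Function.uncurry]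
  · simpa [Function.uncurry] using h i hi

/-- universal derivation -/
def ud : Derivation ℤ (MvPolynomial (Fin 2 × ℕ) ℤ)
    ((Fin 2 × ℕ) →₀ MvPolynomial (Fin 2 × ℕ) ℤ) :=
  mkDerivation ℤ (fun s => Finsupp.single s 1)

/-- specialization of the universal derivation -/
def spec {L : Type*} [Field L] (D : Derivation ℤ L L) (y : Fin 2 × ℕ → L) :
    ((Fin 2 × ℕ) →₀ MvPolynomial (Fin 2 × ℕ) ℤ) →+ L :=
  Finsupp.liftAddHom (fun s => (AddMonoidHom.mulRight (D (y s))).comp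
    (aeval y : MvPolynomial (Fin 2 × ℕ) ℤ →ₐ[ℤ] L).toRingHom.toAddMonoidHom)

lemma spec_smul {L : Type*} [Field L] (D : Derivation ℤ L L) (y : Fin 2 × ℕ → L)
    (P : MvPolynomial (Fin 2 × ℕ) ℤ) (f : (Fin 2 × ℕ) →₀ MvPolynomial (Fin 2 × ℕ) ℤ) :
    spec D y (P • f) = aeval y P * spec D y f := by
  induction f using Finsupp.induction_linear with
  | zero => simp
  | add f g hf hg => rw [smul_add, map_add, hf, hg, map_add, mul_add]
  | single s a => rw [Finsupp.smul_single, spec, Finsupp.liftAddHom_apply_single, Finsupp.liftAddHom_apply_single]; simp [mul_assoc]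

lemma spec_ud {L : Type*} [Field L] (D : Derivation ℤ L L) (y : Fin 2 × ℕ → L)
    (P : MvPolynomial (Fin 2 × ℕ) ℤ) : spec D y (ud P) = D (aeval y P) := by
  induction P using MvPolynomial.induction_on with
  | C a =>
    have : (C a : MvPolynomial (Fin 2 × ℕ) ℤ) = (a : MvPolynomial (Fin 2 × ℕ) ℤ) := by simp
    rw [this, Derivation.map_intCast]; simp
  | add f g hf hg => simp [hf, hg]
  | mul_X f s hf =>
    rw [Derivation.leibniz, map_add, spec_smul, spec_smul, hf, map_mul, Derivation.leibniz, aeval_X]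
    simp [ud, spec, mkDerivation_X]

lemma ud_ghost (n : ℕ) : ∑ i ∈ Finset.range (n + 1), wittAdd p i ^ (p ^ (n - i) - 1) •
      ud (wittAdd p i) =
    (∑ i ∈ Finset.range (n + 1), (X (0, i) : MvPolynomial (Fin 2 × ℕ) ℤ) ^ (p ^ (n - i) - 1) •
      ud (X (0, i))) +
    ∑ i ∈ Finset.range (n + 1), (X (1, i) : MvPolynomial (Fin 2 × ℕ) ℤ) ^ (p ^ (n - i) - 1) •
      ud (X (1, i)) := by
  have key : ∀ T : ℕ → MvPolynomial (Fin 2 × ℕ) ℤ,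
      ud (∑ i ∈ Finset.range (n + 1), (p : MvPolynomial (Fin 2 × ℕ) ℤ) ^ i * T i ^ p ^ (n - i)) =
      (p ^ n) • ∑ i ∈ Finset.range (n + 1), T i ^ (p ^ (n - i) - 1) • ud (T i) := by
    intro T
    rw [map_sum, Finset.smul_sum]
    refine Finset.sum_congr rfl fun i hi => ?_
    rw [Finset.mem_range] at hi
    rw [Derivation.leibniz, Derivation.leibniz_pow]
    have h0 : ud ((p : MvPolynomial (Fin 2 × ℕ) ℤ) ^ i) = 0 := by
      rw [← Nat.cast_pow]; simp
    rw [h0, smul_zero, add_zero]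
    have h1 : (p : MvPolynomial (Fin 2 × ℕ) ℤ) ^ i = ((p ^ i : ℕ) : MvPolynomial (Fin 2 × ℕ) ℤ) := by
      push_cast; rfl
    rw [h1, Nat.cast_smul_eq_nsmul, smul_smul, ← pow_add]
    congr 2; omega
  have h := congrArg ud (ghost p n)
  rw [map_add, key, key, key, ← smul_add] at h
  have hpn : (p ^ n) ≠ 0 := pow_ne_zero _ hp.out.ne_zero
  ext1 s
  have h2 := DFunLike.congr_fun h s
  rw [Finsupp.smul_apply, Finsupp.smul_apply] at h2
  simp only [nsmul_eq_mul] at h2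
  exact mul_left_cancel₀ (by exact_mod_cast hpn) h2

/-- The differential ghost identity. -/
lemma theta {L : Type*} [Field L] (D : Derivation ℤ L L) (y : Fin 2 × ℕ → L) (n : ℕ) :
    ∑ i ∈ Finset.range (n + 1), (aeval y (wittAdd p i)) ^ (p ^ (n - i) - 1) *
      D (aeval y (wittAdd p i)) =
    (∑ i ∈ Finset.range (n + 1), y (0, i) ^ (p ^ (n - i) - 1) * D (y (0, i))) +
    ∑ i ∈ Finset.range (n + 1), y (1, i) ^ (p ^ (n - i) - 1) * D (y (1, i)) := by
  have h := congrArg (spec D y) (ud_ghost p n)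
  rw [map_add, map_sum, map_sum, map_sum] at h
  simpa only [spec_smul, spec_ud, map_pow, aeval_X] using h

end Witt
end S15

namespace S15

section Arith
variable (p r : ℕ) (m : ℕ → ℤ)

/-- upper breaks -/
def uu : ℕ → ℤ
  | 0 => m r
  | i + 1 => max (p * uu i) (m (r + i + 1))

/-- lower breaks -/
def RR : ℕ → ℤ
  | 0 => uu p r m 0
  | i + 1 => RR i + p ^ (i + 1) * (uu p r m (i + 1) - uu p r m i)

/-- derivation defect -/
def dd (i : ℕ) : ℤ := p ^ i * uu p r m i - RR p r m i

variable {p r m}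

lemma uu_pos (hp : 2 ≤ p) (hm : 0 < m r) (i : ℕ) : 0 < uu p r m i := by
  induction i with
  | zero => exact hm
  | succ i ih =>
    have : (0 : ℤ) < p * uu p r m i := mul_pos (by exact_mod_cast (by omega : 0 < p)) ih
    exact lt_of_lt_of_le this (le_max_left _ _)

lemma uu_mul_le (i : ℕ) : p * uu p r m i ≤ uu p r m (i + 1) := le_max_left _ _

lemma uu_lt (hp : 2 ≤ p) (hm : 0 < m r) (i : ℕ) : uu p r m i < uu p r m (i + 1) := by
  have h1 := uu_mul_le (p := p) (r := r) (m := m) i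
  have h2 := uu_pos hp hm i
  have : (2 : ℤ) ≤ p := by exact_mod_cast hp
  nlinarith

lemma m_le_uu (i : ℕ) : m (r + i) ≤ uu p r m i := by
  cases i with
  | zero => exact le_refl _
  | succ i => exact le_max_right _ _

lemma uu_pow_le (l k : ℕ) : (p : ℤ) ^ k * uu p r m l ≤ uu p r m (l + k) := by
  induction k with
  | zero => simp
  | succ k ih =>
    have h1 := uu_mul_le (p := p) (r := r) (m := m) (l + k)
    have h2 := mul_le_mul_of_nonneg_left ih (show (0 : ℤ) ≤ p by positivity)
    rw [pow_succ]
    have : uu p r m (l + (k + 1)) = uu p r m (l + k + 1) := rfl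
    rw [this]
    linarith

lemma RR_bound (hp : 2 ≤ p) (hm : 0 < m r) (i : ℕ) : p ^ i * uu p r m i < p * RR p r m i ∧ 0 < RR p r m i := by
  have hp' : (2 : ℤ) ≤ p := by exact_mod_cast hp
  induction i with
  | zero =>
    have := uu_pos hp hm 0
    simp only [RR, pow_zero, one_mul]
    exact ⟨by nlinarith, this⟩
  | succ i ih =>
    obtain ⟨ih1, ih2⟩ := ih
    have h0 := uu_pos hp hm i
    have h1 := uu_mul_le (p := p) (r := r) (m := m) i
    have h2 := uu_lt hp hm i
    have hpi : (0 : ℤ) < p ^ (i + 1) := by positivity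
    have hR : 0 < RR p r m (i + 1) := by
      simp only [RR]
      have : 0 < (p : ℤ) ^ (i + 1) * (uu p r m (i + 1) - uu p r m i) := mul_pos hpi (by omega)
      omega
    refine ⟨?_, hR⟩
    simp only [RR]
    have h3 : uu p r m (i + 1) ≤ p * (uu p r m (i + 1) - uu p r m i) := by nlinarith
    have h4 := mul_le_mul_of_nonneg_left h3 hpi.le
    nlinarith

lemma RR_lt_succ (hp : 2 ≤ p) (hm : 0 < m r) (i : ℕ) : RR p r m i < RR p r m (i + 1) := by
  have h2 := uu_lt hp hm i
  have hpi : (0 : ℤ) < p ^ (i + 1) := pow_pos (by exact_mod_cast (by omega : 0 < p)) _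
  have := mul_pos hpi (sub_pos.2 h2)
  simp only [RR]; omega

lemma RR_strictMono (hp : 2 ≤ p) (hm : 0 < m r) : StrictMono (RR p r m) := strictMono_nat_of_lt_succ (RR_lt_succ hp hm)

lemma dd_zero : dd p r m 0 = 0 := by simp [dd, RR]

lemma dd_succ (i : ℕ) : dd p r m (i + 1) = p * dd p r m i + (p - 1) * RR p r m i := by
  simp only [dd, RR]; ring

lemma exists_max (hp : 2 ≤ p) (hm : 0 < m r) (hs : ∀ l, m (r + l) ≠ 0 → ¬ (p : ℤ) ∣ m (r + l)) (i : ℕ) :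
    ∃ l₀ ≤ i, uu p r m i = p ^ (i - l₀) * m (r + l₀) ∧ 0 < m (r + l₀) ∧
      ∀ l ≤ i, l ≠ l₀ → m (r + l) ≠ 0 → p ^ (i - l) * m (r + l) < uu p r m i := by
  have hp0 : (0 : ℤ) < p := by exact_mod_cast (by omega : 0 < p)
  induction i with
  | zero =>
    refine ⟨0, le_refl _, by simp [uu], hm, ?_⟩
    intro l hl hl0; omega
  | succ i ih =>
    obtain ⟨l₀, hl₀, h1, h2, h3⟩ := ih
    have hle : ∀ l ≤ i, m (r + l) ≠ 0 → p ^ (i - l) * m (r + l) ≤ uu p r m i := by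
      intro l hl hml
      by_cases h : l = l₀
      · subst h; exact h1.ge
      · exact (h3 l hl h hml).le
    have hpw : ∀ l ≤ i, (p : ℤ) ^ (i + 1 - l) * m (r + l) = p * (p ^ (i - l) * m (r + l)) := by
      intro l hl
      rw [show i + 1 - l = (i - l) + 1 by omega, pow_succ]; ring
    by_cases hc : m (r + (i + 1)) ≤ p * uu p r m i
    · have hu : uu p r m (i + 1) = p * uu p r m i := max_eq_left hc
      refine ⟨l₀, by omega, ?_, h2, ?_⟩
      · rw [hu, hpw l₀ hl₀, h1]
      · intro l hl hne hml
        rw [hu]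
        by_cases hli : l ≤ i
        · rw [hpw l hli]
          exact mul_lt_mul_of_pos_left (h3 l hli hne hml) hp0
        · have : l = i + 1 := by omega
          subst this
          simp only [Nat.sub_self, pow_zero, one_mul]
          refine lt_of_le_of_ne hc ?_
          intro h
          exact hs _ hml ⟨_, h⟩
    · push Not at hc
      have hu : uu p r m (i + 1) = m (r + (i + 1)) := max_eq_right hc.le
      refine ⟨i + 1, le_refl _, by simp [hu], ?_, ?_⟩
      · have := uu_pos hp hm i
        have : 0 < p * uu p r m i := by positivity
        omega
      · intro l hl hne hml
        have hli : l ≤ i := by omega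
        rw [hu, hpw l hli]
        exact lt_of_le_of_lt (mul_le_mul_of_nonneg_left (hle l hli hml) hp0.le) hc

end Arith
end S15

namespace S15

section Tower
open MvPolynomial WittVector
variable {k K L : Type*} [Field k] [Field K] [Field L] [Algebra K L]

/-- The tower of fields generated by the components. -/
def MM (K : Type*) {L : Type*} [Field K] [Field L] [Algebra K L] (x : ℕ → L) (j : ℕ) :
    IntermediateField K L := IntermediateField.adjoin K {α | ∃ i < j, x i = α}

/-- The variables. -/
def yy {K L : Type*} [Field K] [Field L] [Algebra K L] (x : ℕ → L) (a : ℕ → K) : Fin 2 × ℕ → L :=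
  Function.uncurry ![x, fun i => algebraMap K L (a i)]

lemma yy_zero (x : ℕ → L) (a : ℕ → K) (i : ℕ) : yy x a (0, i) = x i := rfl
lemma yy_one (x : ℕ → L) (a : ℕ → K) (i : ℕ) : yy x a (1, i) = algebraMap K L (a i) := rfl

lemma mem_MM (x : ℕ → L) {i j : ℕ} (h : i < j) : x i ∈ MM K x j :=
  IntermediateField.subset_adjoin _ _ ⟨i, h, rfl⟩

variable {p : ℕ} [hp : Fact p.Prime]

lemma MM_mono (x : ℕ → L) {i j : ℕ} (h : i ≤ j) : MM K x i ≤ MM K x j :=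
  IntermediateField.adjoin.mono _ _ _ (fun _ ⟨l, hl, e⟩ => ⟨l, by omega, e⟩)

lemma MM_succ (x : ℕ → L) (j : ℕ) {w z : L} (hz : z ∈ MM K x j) (hw : w = x j + z) :
    (IntermediateField.adjoin (MM K x j) {w}).restrictScalars K = MM K x (j + 1) := by
  apply le_antisymm
  · have h1 : IntermediateField.adjoin (MM K x j) {w} ≤
        IntermediateField.extendScalars (MM_mono (K := K) x (Nat.le_succ j)) := by
      rw [IntermediateField.adjoin_le_iff]
      intro t ht
      rw [Set.mem_singleton_iff.1 ht]
      change w ∈ MM K x (j + 1)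
      rw [hw]
      exact add_mem (mem_MM x (Nat.lt_succ_self j)) (MM_mono x (Nat.le_succ j) hz)
    intro t ht
    exact h1 ht
  · rw [MM, IntermediateField.adjoin_le_iff]
    rintro _ ⟨i, hi, rfl⟩
    change x i ∈ IntermediateField.adjoin (MM K x j) {w}
    have hM : ∀ t (ht : t ∈ MM K x j), t ∈ IntermediateField.adjoin (MM K x j) {w} := fun t ht =>
      (IntermediateField.adjoin (MM K x j) {w}).algebraMap_mem ⟨t, ht⟩
    by_cases h : i < j
    · exact hM _ (mem_MM x h)
    · have : i = j := by omega
      subst this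
      have : x i = w - z := by rw [hw]; ring
      rw [this]
      exact sub_mem (IntermediateField.mem_adjoin_simple_self _ _) (hM _ hz)

variable {v : L → WithTop ℤ}

lemma veq_fp (hv : IsNormVal v) {t : L} (ht : t ^ p = t) (h0 : t ≠ 0) : VEq v t 0 := by
  obtain ⟨z, hz⟩ := exists_veq hv h0
  have h1 := hz.pow hv p
  rw [ht] at h1
  have h2 := hz.unique h1
  have hp2 : (2 : ℤ) ≤ p := by exact_mod_cast hp.out.two_le
  have : z = 0 := by
    have : (p - 1 : ℤ) * z = 0 := by linarith
    rcases mul_eq_zero.1 this with h | h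
    · omega
    · exact h
  rwa [this] at hz

lemma fp_mem [CharP L p] {t : L} (ht : t ^ p = t) (M : IntermediateField K L) : t ∈ M := by
  have h := (Subfield.mem_bot_iff_pow_eq_self L p).2 ht
  have : (⊥ : Subfield L) ≤ M.toSubfield := bot_le
  exact this h

/-- Data of the tower. -/
structure Data (v : L → WithTop ℤ) (p : ℕ) [Fact p.Prime] (ι : K ≃+* LaurentSeries k) (e : ℕ)
    (D : Derivation ℤ L L) (n r : ℕ) (x : ℕ → L) (a : ℕ → K) (m : ℕ → ℤ) : Prop where
  hv : IsNormVal v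
  he : ExtendsWithE (lfVal ι) v e
  he0 : 0 < e
  hD : ∀ t, D (algebraMap K L t) = algebraMap K L (eulerDer ι t)
  hx : ∀ j < n, x j ^ p = aeval (yy x a) (wittAdd p j)
  ha : ∀ j < r, a j = 0
  hr : r < n
  hm : ∀ j, m j = -(ι (a j)).order
  hs : ∀ j, a j ≠ 0 → ¬ (p : ℤ) ∣ m j
  hmr : 0 < m r

/-- The invariant. -/
structure Inv (v : L → WithTop ℤ) (p : ℕ) [Fact p.Prime] (ι : K ≃+* LaurentSeries k) (e : ℕ)
    (D : Derivation ℤ L L) (n r : ℕ) (x : ℕ → L) (a : ℕ → K) (m : ℕ → ℤ) (i : ℕ) (E : ℤ) :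
    Prop where
  hE : p ^ i * E = e
  lay : Layer v (kap ι L) p D (MM K x (r + i)) E (dd p r m i)
  fin : Module.finrank (MM K x (r + i)) L * p ^ i = Module.finrank K L
  bx : ∀ l < i, ∃ g, VGe v (x (r + l)) g ∧ -(e * uu p r m l) ≤ p * g
  bD : ∀ l < i, VEq v (D (x (r + l))) (-(e * uu p r m l))
  sig : ∀ σ : L ≃ₐ[K] L, ∀ l < i, (∀ t ∈ MM K x (r + l), σ t = t) → σ (x (r + l)) ≠ x (r + l) →
    OpGood v p (MM K x (r + i)) E (fun t => σ t - t) (RR p r m l)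

variable {ι : K ≃+* LaurentSeries k} {e : ℕ} {D : Derivation ℤ L L} {n r : ℕ} {x : ℕ → L}
  {a : ℕ → K} {m : ℕ → ℤ}

lemma Data.fp (h : Data v p ι e D n r x a m) : ∀ j < r, x j ^ p = x j := by
  intro j hj
  rw [h.hx j (by have := h.hr; omega)]
  rw [wittAdd_zero p j (yy x a)]
  · rfl
  · intro i hi; rw [yy_one, h.ha i (by omega), map_zero]

lemma Data.base [CharP L p] [CharP k p] (h : Data v p ι e D n r x a m) :
    Inv v p ι e D n r x a m 0 e := by
  have hbot : MM K x r = ⊥ := by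
    rw [eq_bot_iff, MM, IntermediateField.adjoin_le_iff]
    rintro _ ⟨i, hi, rfl⟩
    exact fp_mem (h.fp i hi) _
  refine ⟨by simp, ?_, ?_, ?_, ?_, ?_⟩
  · rw [add_zero, hbot, dd_zero]
    exact base_layer ι h.hv h.he h.he0 D h.hD
  · rw [add_zero, hbot]; simp
  all_goals intros; omega

lemma Data.order (h : Data v p ι e D n r x a m) (j : ℕ) (ha : a j ≠ 0) :
    VEq v (algebraMap K L (a j)) (e * (-m j)) := by
  have := base_veq ι h.he ha
  rwa [h.hm, neg_neg]

lemma Data.a_vge (h : Data v p ι e D n r x a m) (i : ℕ) :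
    VGe v (algebraMap K L (a (r + i))) (-(e * uu p r m i)) := by
  by_cases h0 : a (r + i) = 0
  · rw [h0, map_zero]; exact vge_zero h.hv _
  rw [(h.order _ h0).ge_iff]
  have h1 := m_le_uu (p := p) (r := r) (m := m) i
  have := mul_le_mul_of_nonneg_left h1 (show (0 : ℤ) ≤ e by positivity)
  linarith

lemma Data.uu_pos (h : Data v p ι e D n r x a m) (i : ℕ) : 0 < uu p r m i :=
  S15.uu_pos hp.out.two_le h.hmr i

/-- Bound for `β₀`. -/
lemma Data.beta_vge (h : Data v p ι e D n r x a m) {i : ℕ} {E : ℤ}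
    (I : Inv v p ι e D n r x a m i E) (hi : r + i < n) :
    x (r + i) ^ p - x (r + i) ∈ MM K x (r + i) ∧
    VGe v (x (r + i) ^ p - x (r + i)) (-(e * uu p r m i)) := by
  have hβ : x (r + i) ^ p - x (r + i) =
      algebraMap K L (a (r + i)) + aeval (yy x a) (wq p (r + i)) := by
    rw [h.hx _ hi, wq, map_sub, map_sub, aeval_X, aeval_X, yy_zero, yy_one]; ring
  have hu := h.uu_pos i
  rw [hβ]
  constructor
  · refine add_mem (IntermediateField.algebraMap_mem _ _) (wq_mem p _ _ _ ?_)
    rintro ⟨b, l⟩ hl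
    fin_cases b
    · exact mem_MM x hl
    · exact IntermediateField.algebraMap_mem _ _
  · refine (h.a_vge i).add h.hv (wq_vge p h.hv _ _ _ ?_)
    have hp0 : (0 : ℤ) < p := by exact_mod_cast hp.out.pos
    rintro ⟨b, l⟩ hl
    simp only at hl ⊢
    by_cases hlr : l < r
    · refine ⟨0, ?_, ?_⟩
      · fin_cases b
        · change VGe v (x l) 0
          by_cases h0 : x l = 0
          · rw [h0]; exact vge_zero h.hv _
          · exact (veq_fp h.hv (h.fp l hlr) h0).ge
        · change VGe v (algebraMap K L (a l)) 0
          rw [h.ha l hlr, map_zero]; exact vge_zero h.hv _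
      · rw [zero_mul, neg_nonpos]; positivity
    · obtain ⟨l', rfl⟩ : ∃ l', l = r + l' := ⟨l - r, by omega⟩
      have hu' := h.uu_pos l'
      refine ⟨-(e * uu p r m l'), ?_, ?_⟩
      · fin_cases b
        · obtain ⟨g, hg, hg'⟩ := I.bx l' (by omega)
          refine hg.mono ?_
          have : 0 ≤ e * uu p r m l' := by positivity
          by_contra hcon
          push Not at hcon
          have hp2 : (2 : ℤ) ≤ p := by exact_mod_cast hp.out.two_le
          nlinarith
        · exact h.a_vge l'
      · obtain ⟨s, rfl⟩ : ∃ s, i = l' + s := ⟨i - l', by omega⟩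
        have h1 := uu_pow_le (p := p) (r := r) (m := m) l' s
        have h2 := mul_le_mul_of_nonneg_left h1 (show (0 : ℤ) ≤ e * p ^ (r + l') by positivity)
        have h3 : (p : ℤ) ^ (r + (l' + s)) = p ^ (r + l') * p ^ s := by rw [← pow_add, add_assoc]
        rw [h3]
        linarith

/-- The derivative of the new component. -/
lemma Data.deriv [CharP L p] [CharP k p] (h : Data v p ι e D n r x a m) {i : ℕ} {E : ℤ}
    (I : Inv v p ι e D n r x a m i E) (hi : r + i < n) :
    VEq v (D (x (r + i))) (-(e * uu p r m i)) := by
  have hDp : ∀ t : L, D (t ^ p) = 0 := by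
    intro t; rw [Derivation.leibniz_pow]; simp
  have hp0 : (0 : ℤ) < p := by exact_mod_cast hp.out.pos
  have he0 : (0 : ℤ) < e := by exact_mod_cast h.he0
  have hth := theta p D (yy x a) (r + i)
  have hl : ∑ l ∈ Finset.range (r + i + 1), (aeval (yy x a) (wittAdd p l)) ^ (p ^ (r + i - l) - 1) *
      D (aeval (yy x a) (wittAdd p l)) = 0 := by
    apply Finset.sum_eq_zero
    intro l hl
    rw [Finset.mem_range] at hl
    rw [← h.hx l (by omega), hDp, mul_zero]
  rw [hl, Finset.sum_range_succ] at hth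
  simp only [Nat.sub_self, pow_zero, one_mul, yy_zero, yy_one] at hth
  set A := ∑ l ∈ Finset.range (r + i), x l ^ (p ^ (r + i - l) - 1) * D (x l) with hA
  set B := ∑ l ∈ Finset.range (r + i + 1), algebraMap K L (a l) ^ (p ^ (r + i - l) - 1) *
    D (algebraMap K L (a l)) with hB
  have hx' : D (x (r + i)) = -(B + A) := by linear_combination -hth
  rw [hx']
  apply VEq.neg h.hv
  have base := base_layer (p := p) ι h.hv h.he h.he0 D h.hD
  refine VEq.add_ge h.hv ?_ ?_
  · obtain ⟨l₀, hl₀, h1, h2, h3⟩ := exists_max hp.out.two_le h.hmr (p := p) (r := r) (m := m) (by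
      intro l hl
      apply h.hs
      intro h0
      apply hl
      rw [h.hm, h0]; simp) i
    have hterm : ∀ l ≤ i, a (r + l) ≠ 0 → VEq v (algebraMap K L (a (r + l)) ^
        (p ^ (r + i - (r + l)) - 1) * D (algebraMap K L (a (r + l))))
        (-(e * (p ^ (i - l) * m (r + l)))) := by
      intro l hl h0
      have h4 := base.der.eq _ (IntermediateField.algebraMap_mem _ _) _ (h.order _ h0)
        (by rw [dvd_neg]; exact h.hs _ h0)
      have h5 := ((h.order _ h0).pow h.hv (p ^ (r + i - (r + l)) - 1)).mul h.hv h4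
      convert h5 using 1
      rw [show r + i - (r + l) = i - l by omega]
      have : 1 ≤ p ^ (i - l) := Nat.one_le_pow _ _ hp.out.pos
      push_cast [Nat.cast_sub this]
      ring
    have ha0 : a (r + l₀) ≠ 0 := by
      intro h0
      have := h.hm (r + l₀)
      rw [h0] at this
      simp at this
      omega
    apply veq_sum_of h.hv _ _ (r + l₀) (Finset.mem_range.2 (by omega))
    · rw [h1]; exact hterm l₀ hl₀ ha0
    · intro l hl hne
      rw [Finset.mem_range] at hl
      by_cases h0 : a l = 0
      · simp only [h0, map_zero, mul_zero]; exact vge_zero h.hv _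
      have hlr : r ≤ l := by
        by_contra hcon
        exact h0 (h.ha l (by omega))
      obtain ⟨l', rfl⟩ : ∃ l', l = r + l' := ⟨l - r, by omega⟩
      rw [(hterm l' (by omega) h0).ge_iff]
      have hm0 : m (r + l') ≠ 0 := by
        intro hm0
        have := h.hs _ h0
        rw [hm0] at this
        simp at this
      have := h3 l' (by omega) (by omega) hm0
      have := mul_lt_mul_of_pos_left this he0
      linarith
  · apply vge_sum h.hv
    intro l hl
    rw [Finset.mem_range] at hl
    by_cases hlr : l < r
    · have : D (x l) = 0 := by rw [← h.fp l hlr, hDp]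
      rw [this, mul_zero]; exact vge_zero h.hv _
    · obtain ⟨l', rfl⟩ : ∃ l', l = r + l' := ⟨l - r, by omega⟩
      obtain ⟨g, hg, hg'⟩ := I.bx l' (by omega)
      obtain ⟨s, rfl⟩ : ∃ s, i = l' + (s + 1) := ⟨i - l' - 1, by omega⟩
      refine ((hg.pow h.hv _).mul h.hv (I.bD l' (by omega)).ge).mono ?_
      rw [show r + (l' + (s + 1)) - (r + l') = s + 1 by omega]
      have h1 : 1 ≤ p ^ (s + 1) := Nat.one_le_pow _ _ hp.out.pos
      have h1' : (2 : ℤ) ≤ p ^ (s + 1) := by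
        have h2 : p ^ 1 ≤ p ^ (s + 1) := Nat.pow_le_pow_right hp.out.pos (by omega)
        rw [pow_one] at h2
        have := hp.out.two_le
        exact_mod_cast (by omega : 2 ≤ p ^ (s + 1))
      have hp2 : (2 : ℤ) ≤ p := by exact_mod_cast hp.out.two_le
      push_cast [Nat.cast_sub h1]
      set q : ℤ := p ^ (s + 1)
      have h2 := uu_pow_le (p := p) (r := r) (m := m) l' (s + 1)
      have h3 := mul_le_mul_of_nonneg_left h2 he0.le
      have hu := mul_pos he0 (h.uu_pos l')
      set u := (e : ℤ) * uu p r m l'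
      have h4 := mul_le_mul_of_nonneg_left hg' (show (0 : ℤ) ≤ q - 1 by omega)
      set W := (e : ℤ) * uu p r m (l' + (s + 1))
      have h5 : q * u ≤ W := by
        calc q * u = e * (q * uu p r m l') := by ring
          _ ≤ W := h3
      have h6 : 0 < (p - 1 : ℤ) * (q - 1) * u := by
        apply mul_pos (mul_pos (by omega) (by omega)) hu
      by_contra hcon
      push Not at hcon
      have h7 : (q - 1) * g - u ≤ - W := by linarith
      have h8 := mul_le_mul_of_nonneg_left h7 hp0.le
      have h9 := mul_le_mul_of_nonneg_left h5 hp0.le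
      nlinarith

lemma Data.step [CharP L p] [CharP k p] [PerfectField k] [FiniteDimensional K L]
    (h : Data v p ι e D n r x a m) {i : ℕ} {E : ℤ}
    (I : Inv v p ι e D n r x a m i E) (hi : r + i < n) :
    ∃ E', Inv v p ι e D n r x a m (i + 1) E' := by
  have hDp : ∀ t : L, D (t ^ p) = 0 := by
    intro t; rw [Derivation.leibniz_pow]; simp
  have hp0 : (0 : ℤ) < p := by exact_mod_cast hp.out.pos
  have he0 : (0 : ℤ) < e := by exact_mod_cast h.he0
  have hE0 := I.lay.pos
  have hv := h.hv
  obtain ⟨hRb, hR0⟩ := RR_bound hp.out.two_le h.hmr i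
  set R := RR p r m i with hRdef
  obtain ⟨hβM, hβv⟩ := h.beta_vge I hi
  have hDx := h.deriv I hi
  set X := x (r + i) with hX
  set M := MM K x (r + i) with hMdef
  have heu : (e : ℤ) * uu p r m i = E * (p ^ i * uu p r m i) := by rw [← I.hE]; ring
  have hu := h.uu_pos i
  obtain ⟨B, hB⟩ : ∃ B : ℕ, (B : ℤ) = e * uu p r m i :=
    ⟨(e * uu p r m i).toNat, Int.toNat_of_nonneg (by positivity)⟩
  rw [← hB] at hβv
  obtain ⟨z, hzM, ⟨g, hzg, hg⟩, hred⟩ := reduction hv I.lay (kap_mem ι _) B _ hβM hβv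
  set β := X ^ p - X + z ^ p - z with hβ
  set w := X + z with hw
  have hwβ : w ^ p - w = β := by rw [hw, hβ, add_pow_char]; ring
  have hβM' : β ∈ M := sub_mem (add_mem hβM (pow_mem hzM _)) hzM
  have hDβ : VEq v (D β) (-(e * uu p r m i)) := by
    have h1 : D β = -(D X) + -(D z) := by
      rw [hβ, map_sub, map_add, map_sub, hDp, hDp]; ring
    rw [h1]
    refine (hDx.neg hv).add_ge hv (VGe.neg hv ?_)
    refine (I.lay.der.ge z hzM g hzg).mono ?_
    rw [hB] at hg
    rw [heu] at hg ⊢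
    have h2 := mul_lt_mul_of_pos_left hRb hE0
    have h3 : -(E * R) < g := by
      by_contra hcon
      push Not at hcon
      have := mul_le_mul_of_nonneg_left hcon hp0.le
      nlinarith
    simp only [dd]
    linarith
  have hβR : VEq v β (-(E * R)) ∧ ¬ (p : ℤ) ∣ R := by
    rcases hred with h0 | ⟨q, hpq, hq⟩
    · exfalso
      have h1 := I.lay.der.ge β hβM' 0 h0
      rw [hDβ.ge_iff, heu] at h1
      have := mul_pos hE0 hR0
      simp only [dd] at h1
      linarith
    · have h1 := (I.lay.der.eq β hβM' q hq hpq).unique hDβ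
      have h2 : q = -R := by
        rw [heu] at h1
        have h3 : E * (q + -dd p r m i) = E * (-(p ^ i * uu p r m i)) := by linarith
        have h4 := mul_left_cancel₀ hE0.ne' h3
        simp only [dd] at h4
        linarith
      rw [h2] at hq hpq
      exact ⟨by convert hq using 1; ring, by rwa [dvd_neg] at hpq⟩
  obtain ⟨hβv', hpR⟩ := hβR
  have hM' : (IntermediateField.adjoin M {w}).restrictScalars K = MM K x (r + (i + 1)) :=
    MM_succ x (r + i) hzM hw
  have hdec := dec_simple M hβM' hwβ
  rw [hM'] at hdec
  have hMM' : M ≤ MM K x (r + (i + 1)) := MM_mono x (by omega)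
  have hXM' : X ∈ MM K x (r + (i + 1)) := mem_MM x (by omega)
  obtain ⟨E', hEE', hE'0, hwv, hlay⟩ := layer_step hv I.lay hβM' hβv' hpR hR0 hwβ hMM'
    (add_mem hXM' (hMM' hzM)) hdec
  have hfin := finrank_simple hv hE'0 hEE' I.lay.val hwv hpR hβM' hwβ
  rw [hM'] at hfin
  refine ⟨E', ?_, ?_, ?_, ?_, ?_, ?_⟩
  · rw [← I.hE, hEE']; ring
  · rw [dd_succ]; exact hlay
  · rw [← I.fin, ← hMdef, hfin]; ring
  · intro l hl
    by_cases hli : l < i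
    · exact I.bx l hli
    · have : l = i := by omega
      subst this
      obtain ⟨y, hy, hy'⟩ := as_vge hv hp.out.two_le (rfl : X ^ p - X = X ^ p - X)
        (by positivity) hβv
      exact ⟨y, hy', by rw [← hB]; exact hy⟩
  · intro l hl
    by_cases hli : l < i
    · exact I.bD l hli
    · have : l = i := by omega
      subst this
      exact hDx
  · intro σ l hl hfix hmove
    have hRl := (RR_bound hp.out.two_le h.hmr l).2
    have hEl := mul_pos hE'0 hRl
    refine sigma_step hv hE'0 hEE' I.lay.val hwv hpR hdec σ hRl ?_ ?_
    · intro t ht z hz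
      by_cases hli : l < i
      · refine ((I.sig σ l hli hfix hmove).ge t ht z hz).mono ?_
        have hp2 : (2 : ℤ) ≤ p := by exact_mod_cast hp.out.two_le
        rw [hEE']
        nlinarith
      · have : l = i := by omega
        subst this
        rw [hfix t ht, sub_self]; exact vge_zero hv _
    · have hδ : (σ w - w) ^ p - (σ w - w) = σ β - β := by
        rw [sub_pow_char, ← hwβ, map_sub, map_pow]; ring
      by_cases hli : l < i
      · have h1 := (I.sig σ l hli hfix hmove).eq β hβM' (-R) (by rw [mul_neg]; exact hβv')
          (by rwa [dvd_neg])
        have hlt : RR p r m l < R := RR_strictMono hp.out.two_le h.hmr hli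
        have hneg : E * (-R + RR p r m l) < 0 := by nlinarith
        obtain ⟨y, hy, hy'⟩ := as_veq hv hp.out.two_le hδ h1 hneg
        have : y = -(E' * R) + E' * RR p r m l := by
          apply mul_left_cancel₀ hp0.ne'
          rw [← hy, hEE']; ring
        rwa [this] at hy'
      · have hl' : l = i := by omega
        subst hl'
        rw [hfix β hβM', sub_self] at hδ
        have h1 : σ w - w ≠ 0 := by
          rw [hw, map_add, hfix z hzM]
          intro h0
          apply hmove
          linear_combination h0
        have := veq_fp hv (sub_eq_zero.1 hδ) h1
        rw [neg_add_cancel]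
        exact this

end Tower
end S15

namespace S15

section Herbrand

lemma antitone_ind (P : Prop) (c : ℝ) : Antitone (fun t : ℝ => if P ∨ t ≤ c then (1 : ℝ) else 0) := by
  intro a b hab
  simp only
  split_ifs with h1 h2
  · exact le_refl _
  · exfalso; apply h2; rcases h1 with h | h
    · exact Or.inl h
    · exact Or.inr (hab.trans h)
  · exact zero_le_one
  · exact le_refl _

lemma integral_ind (P : Prop) {c x : ℝ} (hc : 0 ≤ c) (hx : 0 ≤ x) :
    ∫ t in (0 : ℝ)..x, (if P ∨ t ≤ c then (1 : ℝ) else 0) = if P then x else min x c := by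
  have hIgr : ∀ a b, IntervalIntegrable (fun t : ℝ => if P ∨ t ≤ c then (1 : ℝ) else 0)
      MeasureTheory.volume a b := fun a b => (antitone_ind P c).intervalIntegrable
  have one : ∀ y, 0 ≤ y → (P ∨ y ≤ c) →
      ∫ t in (0 : ℝ)..y, (if P ∨ t ≤ c then (1 : ℝ) else 0) = y := by
    intro y hy hyc
    have : ∫ t in (0 : ℝ)..y, (if P ∨ t ≤ c then (1 : ℝ) else 0) = ∫ t in (0 : ℝ)..y, (1 : ℝ) := by
      apply intervalIntegral.integral_congr
      intro t ht
      rw [Set.uIcc_of_le hy] at ht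
      have : P ∨ t ≤ c := by
        rcases hyc with h | h
        · exact Or.inl h
        · exact Or.inr (ht.2.trans h)
      simp [this]
    rw [this]; simp
  by_cases hP : P
  · rw [if_pos hP]; exact one x hx (Or.inl hP)
  rw [if_neg hP]
  rcases le_total x c with h | h
  · rw [min_eq_left h]; exact one x hx (Or.inr h)
  · rw [min_eq_right h, ← intervalIntegral.integral_add_adjacent_intervals (hIgr 0 c) (hIgr c x),
      one c hc (Or.inr le_rfl)]
    rw [intervalIntegral.integral_zero_ae, add_zero]
    refine Filter.Eventually.of_forall fun t ht => ?_
    rw [Set.uIoc_of_le h] at ht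
    rw [if_neg]
    rintro (h' | h')
    · exact hP h'
    · exact absurd ht.1 (not_lt.2 h')

variable {K L : Type*} [Field K] [Field L] [Algebra K L] [FiniteDimensional K L]
variable {v : L → WithTop ℤ}

theorem herbrand (hv : IsNormVal v) (π : L) (c : (L ≃ₐ[K] L) → ℤ)
    (hc0 : ∀ σ, 0 < c σ)
    (hc : ∀ σ, σ ≠ 1 → InInertia v σ ∧ VEq v (σ π - π) (1 + c σ))
    (l : ℤ) (hl : ∀ σ, c σ ≤ l) (hl1 : c 1 = l) (hl' : ∃ σ, σ ≠ 1 ∧ c σ = l) (U : ℝ)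
    (hU : (∑ σ, (c σ : ℝ)) = Nat.card (L ≃ₐ[K] L) * U) :
    IsUpperBreak K v π U ∧ ∀ u' : ℝ, IsUpperBreak K v π u' → u' ≤ U := by
  have hram : ∀ t : ℝ, ramGrp K v π t = {σ | σ = 1 ∨ t ≤ c σ} := by
    intro t
    ext σ
    simp only [ramGrp, Set.mem_setOf_eq]
    by_cases h1 : σ = 1
    · subst h1
      have h0 : v 0 = ⊤ := (hv.1 0).2 rfl
      simp [InInertia, h0]
    · obtain ⟨h2, h3⟩ := hc σ h1
      have h4 : ((⌈t + 1⌉ : ℤ) : WithTop ℤ) ≤ v (σ π - π) ↔ t ≤ c σ := by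
        refine h3.ge_iff.trans ?_
        rw [Int.ceil_le]
        push_cast
        constructor <;> intro h <;> linarith
      rw [h4]
      simp [h1, h2]
  have hcardpos : (0 : ℝ) < Nat.card (L ≃ₐ[K] L) := by
    exact_mod_cast Nat.card_pos
  have hncard : ∀ t : ℝ, ((ramGrp K v π t).ncard : ℝ) =
      ∑ σ : L ≃ₐ[K] L, if σ = 1 ∨ t ≤ c σ then (1 : ℝ) else 0 := by
    intro t
    rw [hram, Set.ncard_eq_toFinset_card', Finset.sum_boole]
    congr 2
    ext σ; simp
  have hncard0 : ((ramGrp K v π 0).ncard : ℝ) = Nat.card (L ≃ₐ[K] L) := by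
    rw [hncard, Finset.sum_congr rfl (g := fun _ => (1 : ℝ))]
    · simp [Nat.card_eq_fintype_card]
    · intro σ _
      rw [if_pos]
      right
      exact_mod_cast (hc0 σ).le
  set g : ℝ := ((Nat.card (L ≃ₐ[K] L) : ℕ) : ℝ) with hg
  have hphi : ∀ x : ℝ, 0 ≤ x → hhPhi K v π x =
      (∑ σ : L ≃ₐ[K] L, if σ = 1 then x else min x (c σ)) / g := by
    intro x hx
    unfold hhPhi
    simp only [hncard0, hncard]
    rw [intervalIntegral.integral_div, intervalIntegral.integral_finsetSum]
    · congr 1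
      refine Finset.sum_congr rfl fun σ _ => ?_
      exact integral_ind _ (by exact_mod_cast (hc0 σ).le) hx
    · intro σ _
      exact (antitone_ind _ _).intervalIntegrable
  have hl0 : (0 : ℝ) < l := by rw [← hl1]; exact_mod_cast hc0 1
  have hphil : ∀ x : ℝ, (l : ℝ) ≤ x → hhPhi K v π x = U + (x - l) / g := by
    intro x hx
    rw [hphi x (hl0.le.trans hx)]
    have h1 : ∀ σ : L ≃ₐ[K] L, (if σ = 1 then x else min x (c σ)) =
        c σ + if σ = 1 then (x - l) else 0 := by
      intro σ
      by_cases h : σ = 1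
      · subst h; simp [hl1]
      · have : (c σ : ℝ) ≤ l := by exact_mod_cast hl σ
        simp [h, this.trans hx]
    rw [Finset.sum_congr rfl (fun σ _ => h1 σ), Finset.sum_add_distrib, hU, Finset.sum_ite_eq']
    simp only [Finset.mem_univ, if_true]
    field_simp
  have hmono : StrictMonoOn (hhPhi K v π) (Set.Ici 0) := by
    intro x hx y hy hxy
    rw [hphi x hx, hphi y hy]
    apply div_lt_div_of_pos_right _ hcardpos
    apply Finset.sum_lt_sum
    · intro σ _
      split_ifs
      · exact hxy.le
      · exact min_le_min_right _ hxy.le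
    · exact ⟨1, Finset.mem_univ _, by simpa using hxy⟩
  have hpsi : ∀ u : ℝ, U ≤ u → hhPsi K v π u = l + g * (u - U) := by
    intro u hu
    have hxl : (l : ℝ) ≤ l + g * (u - U) := by
      have : 0 ≤ g * (u - U) := mul_nonneg hcardpos.le (by linarith)
      linarith
    have hx0 : l + g * (u - U) ∈ Set.Ici (0 : ℝ) := hl0.le.trans hxl
    have hx : hhPhi K v π (l + g * (u - U)) = u := by
      rw [hphil _ hxl]; field_simp; ring
    have hex : ∃ y ∈ Set.Ici (0 : ℝ), hhPhi K v π y = u := ⟨_, hx0, hx⟩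
    apply hmono.injOn (Function.invFunOn_mem hex) hx0
    rw [hx]; exact Function.invFunOn_eq hex
  have hup : ∀ u : ℝ, U < u → upperRamGrp K v π u = {1} := by
    intro u hu
    rw [upperRamGrp, hpsi u hu.le, hram]
    ext σ
    simp only [Set.mem_setOf_eq, Set.mem_singleton_iff, or_iff_left_iff_imp]
    intro h
    exfalso
    have h1 : (c σ : ℝ) ≤ l := by exact_mod_cast hl σ
    have : 0 < g * (u - U) := mul_pos hcardpos (by linarith)
    linarith
  refine ⟨⟨?_, ?_⟩, ?_⟩
  · by_contra hcon
    push Not at hcon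
    have h1 : g * U < 0 := mul_neg_of_pos_of_neg hcardpos hcon
    rw [← hU] at h1
    have : 0 ≤ ∑ σ, (c σ : ℝ) := Finset.sum_nonneg fun σ _ => by exact_mod_cast (hc0 σ).le
    linarith
  · intro ε hε
    rw [hup _ (by linarith)]
    obtain ⟨σ, hσ, hσl⟩ := hl'
    intro h
    have : σ ∈ upperRamGrp K v π U := by
      rw [upperRamGrp, hpsi U le_rfl, hram]
      right
      simp [hσl]
    rw [← h] at this
    exact hσ this
  · intro u' hu'
    by_contra hcon
    push Not at hcon
    apply hu'.2 1 one_pos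
    rw [hup _ hcon, hup _ (by linarith)]

end Herbrand
end S15

namespace S15

section Core
variable {k K L : Type*} [Field k] [Field K] [Field L] [Algebra K L]
variable {p : ℕ} [hp : Fact p.Prime]
variable {v : L → WithTop ℤ}
variable {ι : K ≃+* LaurentSeries k} {e : ℕ} {D : Derivation ℤ L L} {n r : ℕ} {x : ℕ → L}
  {a : ℕ → K} {m : ℕ → ℤ}

lemma Data.all [CharP L p] [CharP k p] [PerfectField k] [FiniteDimensional K L]
    (h : Data v p ι e D n r x a m) : ∀ i, r + i ≤ n → ∃ E, Inv v p ι e D n r x a m i E := by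
  intro i
  induction i with
  | zero => intro _; exact ⟨e, h.base⟩
  | succ i ih =>
    intro hi
    obtain ⟨E, I⟩ := ih (by omega)
    exact h.step I (by omega)

/-- `σ` fixes the `s`-th layer. -/
def Fx (x : ℕ → L) (r : ℕ) (σ : L ≃ₐ[K] L) (s : ℕ) : Prop := ∀ t ∈ MM K x (r + s), σ t = t

/-- The level of `σ`. -/
def lev (x : ℕ → L) (r Q : ℕ) (σ : L ≃ₐ[K] L) : ℕ := Nat.findGreatest (Fx x r σ) Q

lemma Fx_succ {σ : L ≃ₐ[K] L} {s : ℕ} (h : Fx x r σ s) (h2 : σ (x (r + s)) = x (r + s)) :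
    Fx x r σ (s + 1) := by
  have : MM K x (r + (s + 1)) ≤ IntermediateField.fixedField (Subgroup.zpowers σ) := by
    rw [MM, IntermediateField.adjoin_le_iff]
    rintro _ ⟨i, hi, rfl⟩
    have hσ : σ (x i) = x i := by
      by_cases hi' : i < r + s
      · exact h _ (mem_MM x hi')
      · have : i = r + s := by omega
        rw [this]; exact h2
    rintro ⟨τ, hτ⟩
    change τ (x i) = x i
    have h3 : Subgroup.zpowers σ ≤ MulAction.stabilizer (L ≃ₐ[K] L) (x i) := by
      rw [Subgroup.zpowers_le]; exact hσ
    exact h3 hτ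
  intro t ht
  exact this ht ⟨σ, Subgroup.mem_zpowers σ⟩

theorem core [CharP L p] [CharP k p] [PerfectField k] [FiniteDimensional K L] [IsGalois K L]
    (h : Data v p ι e D n r x a m) (htop : MM K x n = ⊤) (π : L) (hπ : v π = (1 : ℤ)) :
    IsUpperBreak K v π (uu p r m (n - 1 - r) : ℝ) ∧
      ∀ u' : ℝ, IsUpperBreak K v π u' → u' ≤ (uu p r m (n - 1 - r) : ℝ) := by
  have hp2 := hp.out.two_le
  have hm := h.hmr
  obtain ⟨Q, hQ⟩ : ∃ Q, n = r + (Q + 1) := ⟨n - 1 - r, by have := h.hr; omega⟩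
  have hQ' : n - 1 - r = Q := by omega
  rw [hQ']
  obtain ⟨E, I⟩ := h.all (Q + 1) (by omega)
  have hπ' : VEq v π 1 := hπ
  have hπ0 : π ≠ 0 := hπ'.ne_zero h.hv
  have htop' : MM K x (r + (Q + 1)) = ⊤ := by rw [← hQ]; exact htop
  have mem : ∀ t : L, t ∈ MM K x (r + (Q + 1)) := fun t => by rw [htop']; trivial
  have hE1 : E = 1 := by
    obtain ⟨z, hz⟩ := I.lay.val π (mem π) hπ0
    have h1 := hπ'.unique hz
    exact Int.eq_one_of_dvd_one I.lay.pos.le ⟨z, h1⟩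
  subst hE1
  have hfin : Module.finrank K L = p ^ (Q + 1) := by
    have h1 := I.fin
    rw [htop'] at h1
    rw [← h1]; simp
  have hcard : Nat.card (L ≃ₐ[K] L) = p ^ (Q + 1) := by
    rw [IsGalois.card_aut_eq_finrank, hfin]
  have hFcard : ∀ s ≤ Q, (Finset.univ.filter (fun σ : L ≃ₐ[K] L => Fx x r σ s)).card =
      p ^ (Q + 1 - s) := by
    intro s hs
    obtain ⟨E', I'⟩ := h.all s (by omega)
    have h1 := I'.fin
    rw [hfin] at h1
    have h2 : Module.finrank (MM K x (r + s)) L = p ^ (Q + 1 - s) := by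
      apply Nat.eq_of_mul_eq_mul_right (pow_pos hp.out.pos s)
      rw [h1, ← pow_add]; congr 1; omega
    rw [← h2, ← IsGalois.card_fixingSubgroup_eq_finrank, Nat.card_eq_fintype_card,
      Fintype.card_subtype]
    congr 1
    ext σ
    rw [Finset.mem_filter, Finset.mem_filter, IntermediateField.mem_fixingSubgroup_iff]
    rfl
  have P0 : ∀ σ : L ≃ₐ[K] L, Fx x r σ 0 := by
    intro σ
    have hbot : MM K x r = ⊥ := by
      rw [eq_bot_iff, MM, IntermediateField.adjoin_le_iff]
      rintro _ ⟨i, hi, rfl⟩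
      exact fp_mem (h.fp i hi) _
    intro t ht
    rw [add_zero, hbot, IntermediateField.mem_bot] at ht
    obtain ⟨y, rfl⟩ := ht
    simp
  have hlevP : ∀ σ : L ≃ₐ[K] L, Fx x r σ (lev x r Q σ) := fun σ =>
    Nat.findGreatest_spec (P := Fx x r σ) (Nat.zero_le Q) (P0 σ)
  have hlevle : ∀ σ : L ≃ₐ[K] L, lev x r Q σ ≤ Q := fun σ => Nat.findGreatest_le _
  have hlev : ∀ σ : L ≃ₐ[K] L, ∀ s ≤ Q, (s ≤ lev x r Q σ ↔ Fx x r σ s) := by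
    intro σ s hs
    constructor
    · intro h1 t ht
      exact hlevP σ t (MM_mono x (by omega) ht)
    · intro h1
      exact Nat.le_findGreatest hs h1
  have hlev1 : lev x r Q (1 : L ≃ₐ[K] L) = Q :=
    le_antisymm (hlevle 1) ((hlev 1 Q le_rfl).2 (fun t _ => rfl))
  have hne : ∀ σ : L ≃ₐ[K] L, σ ≠ 1 → σ (x (r + lev x r Q σ)) ≠ x (r + lev x r Q σ) := by
    intro σ hσ hcon
    have h1 := Fx_succ (hlevP σ) hcon
    by_cases hq : lev x r Q σ + 1 ≤ Q
    · have := (hlev σ _ hq).2 h1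
      omega
    · have h2 : lev x r Q σ = Q := by have := hlevle σ; omega
      rw [h2] at h1
      apply hσ
      ext t
      exact h1 t (mem t)
  have hRpos : ∀ i, 0 < RR p r m i := fun i => (RR_bound hp2 hm i).2
  have hmono : Monotone (RR p r m) := (RR_strictMono hp2 hm).monotone
  apply herbrand h.hv π (fun σ => RR p r m (lev x r Q σ)) (fun σ => hRpos _) ?_ (RR p r m Q)
    (fun σ => hmono (hlevle σ)) (by simp only [hlev1]) ?_ _ ?_
  · intro σ hσ
    have hg := I.sig σ (lev x r Q σ) (by have := hlevle σ; omega) (hlevP σ) (hne σ hσ)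
    constructor
    · intro t ht
      have h1 := hg.ge t (mem t) 0 ht
      exact h1.mono (by have := hRpos (lev x r Q σ); omega)
    · have h1 := hg.eq π (mem π) 1 (by simpa using hπ') (by
        intro hd
        have h3 := Int.le_of_dvd one_pos hd
        have : (2 : ℤ) ≤ p := by exact_mod_cast hp2
        omega)
      simpa using h1
  · have h1 := hFcard Q le_rfl
    have h2 : 1 < (Finset.univ.filter (fun σ : L ≃ₐ[K] L => Fx x r σ Q)).card := by
      rw [h1, show Q + 1 - Q = 1 by omega, pow_one]; omega
    obtain ⟨σ, hσ, hσ1⟩ := Finset.exists_mem_ne h2 1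
    refine ⟨σ, hσ1, ?_⟩
    have h3 := (hlev σ Q le_rfl).2 (Finset.mem_filter.1 hσ).2
    simp only [le_antisymm (hlevle σ) h3]
  · have hsum : ∀ j ≤ Q, ∑ σ : L ≃ₐ[K] L, RR p r m (min (lev x r Q σ) j) =
        p ^ (Q + 1) * uu p r m j := by
      intro j
      induction j with
      | zero =>
        intro _
        simp only [Nat.min_zero, Finset.sum_const, Finset.card_univ, ← Nat.card_eq_fintype_card,
          hcard, RR]
        simp
      | succ j ih =>
        intro hj
        have h1 : ∀ σ : L ≃ₐ[K] L, RR p r m (min (lev x r Q σ) (j + 1)) =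
            RR p r m (min (lev x r Q σ) j) +
              if Fx x r σ (j + 1) then p ^ (j + 1) * (uu p r m (j + 1) - uu p r m j) else 0 := by
          intro σ
          by_cases hF : Fx x r σ (j + 1)
          · have h2 := (hlev σ _ hj).2 hF
            rw [if_pos hF, min_eq_right h2, min_eq_right (by omega)]
            rfl
          · have h2 : ¬ (j + 1 ≤ lev x r Q σ) := fun h3 => hF ((hlev σ _ hj).1 h3)
            rw [if_neg hF, min_eq_left (by omega), min_eq_left (by omega), add_zero]
        rw [Finset.sum_congr rfl (fun σ _ => h1 σ), Finset.sum_add_distrib, ih (by omega),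
          ← Finset.sum_filter, Finset.sum_const, hFcard _ hj, nsmul_eq_mul]
        have h4 : ((p ^ (Q + 1 - (j + 1)) : ℕ) : ℤ) * p ^ (j + 1) = p ^ (Q + 1) := by
          push_cast
          rw [← pow_add]; congr 1; omega
        rw [← mul_assoc, h4]; ring
    have h5 := hsum Q le_rfl
    simp only [min_eq_left (hlevle _)] at h5
    rw [hcard]
    exact_mod_cast h5

end Core
end S15

namespace S15

section Red
open MvPolynomial WittVector
variable {p : ℕ} [hp : Fact p.Prime]

lemma witt_eq {S : Type*} [CommRing S] {n : ℕ} (x b : TruncatedWittVector p n S)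
    (hx : wittF x = x + b) (X B : ℕ → S) (hX : ∀ j : Fin n, X j = x.coeff j)
    (hB : ∀ j : Fin n, B j = b.coeff j) (j : ℕ) (hj : j < n) :
    X j ^ p = aeval (Function.uncurry ![X, B]) (wittAdd p j) := by
  have h1 : WittVector.truncateFun n (WittVector.mk p X) = x := by
    apply TruncatedWittVector.ext
    intro i
    rw [WittVector.coeff_truncateFun, ← hX]
    rfl
  have h2 : WittVector.truncateFun n (WittVector.mk p B) = b := by
    apply TruncatedWittVector.ext
    intro i
    rw [WittVector.coeff_truncateFun, ← hB]
    rfl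
  have h3 := congrArg (fun w => TruncatedWittVector.coeff ⟨j, hj⟩ w) hx
  simp only [wittF, TruncatedWittVector.coeff_mk] at h3
  rw [← h1, ← h2, ← WittVector.truncateFun_add, WittVector.coeff_truncateFun, WittVector.coeff_truncateFun,
    WittVector.add_coeff] at h3
  exact h3

/-- Two solutions of the same equation differ by elements of the prime field. -/
lemma witt_diff {S : Type*} [Field S] [CharP S p] {n : ℕ} (X Y B : ℕ → S)
    (hX : ∀ j < n, X j ^ p = aeval (Function.uncurry ![X, B]) (wittAdd p j))
    (hY : ∀ j < n, Y j ^ p = aeval (Function.uncurry ![Y, B]) (wittAdd p j)) :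
    ∃ C : ℕ → S, (∀ j < n, C j ^ p = C j) ∧
      ∀ j, Y j = aeval (Function.uncurry ![X, C]) (wittAdd p j) := by
  have key : ∀ X : ℕ → S, (∀ j < n, X j ^ p = aeval (Function.uncurry ![X, B]) (wittAdd p j)) →
      WittVector.truncate n (WittVector.frobenius (WittVector.mk p X)) =
        WittVector.truncate n (WittVector.mk p X) + WittVector.truncate n (WittVector.mk p B) := by
    intro X hX
    rw [← map_add]
    apply TruncatedWittVector.ext
    intro i
    rw [WittVector.coeff_truncate, WittVector.coeff_truncate, WittVector.coeff_frobenius_charP,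
      WittVector.add_coeff]
    exact hX i i.2
  refine ⟨(WittVector.mk p Y - WittVector.mk p X).coeff, ?_, ?_⟩
  · intro j hj
    have h1 : WittVector.truncate n (WittVector.frobenius (WittVector.mk p Y - WittVector.mk p X)) =
        WittVector.truncate n (WittVector.mk p Y - WittVector.mk p X) := by
      rw [map_sub, map_sub, map_sub, key X hX, key Y hY]
      ring
    have h2 := congrArg (fun w => TruncatedWittVector.coeff ⟨j, hj⟩ w) h1
    simp only [WittVector.coeff_truncate, WittVector.coeff_frobenius_charP] at h2
    exact h2
  · intro j
    have h1 : WittVector.mk p Y = WittVector.mk p X + (WittVector.mk p Y - WittVector.mk p X) := by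
      ring
    have h2 := congrArg (fun w : WittVector p S => w.coeff j) h1
    simp only [WittVector.add_coeff] at h2
    exact h2

lemma aeval_mem {K S : Type*} [Field K] [Field S] [Algebra K S] (M : IntermediateField K S) (j : ℕ)
    (y : Fin 2 × ℕ → S) (hy : ∀ s, s.2 ≤ j → y s ∈ M) : aeval y (wittAdd p j) ∈ M := by
  rw [wittAdd_congr p j y (fun s => if s.2 ≤ j then y s else 0)]
  · rw [aeval_def, eval₂_eq]
    refine sum_mem fun d _ => mul_mem ?_ (prod_mem fun s _ => pow_mem ?_ _)
    · exact intCast_mem M _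
    · split_ifs with h
      · exact hy s h
      · exact zero_mem M
  · intro s hs; rw [if_pos hs]

variable {k K : Type} [Field k] [Field K] [PerfectField k] [CharP k p] [CharP K p]

theorem main (ι : K ≃+* LaurentSeries k)
    (n r : ℕ) (hr2 : r ≤ n - 1) (hrn : r < n)
    (a : TruncatedWittVector p n K)
    (hzero : ∀ j : Fin n, (j : ℕ) < r → a.coeff j = 0)
    (har : a.coeff ⟨r, hrn⟩ ≠ 0)
    (harneg : lfVal ι (a.coeff ⟨r, hrn⟩) < (0 : ℤ))
    (hstrong : ∀ i : Fin n, a.coeff i = 0 ∨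
      ∀ z : ℤ, lfVal ι (a.coeff i) = (z : WithTop ℤ) → ¬ (p : ℤ) ∣ z)
    (m : ℕ → ℤ) (hm : ∀ i : Fin n, m (i : ℕ) = -(ι (a.coeff i)).order)
    (x : TruncatedWittVector p n (SepCl K))
    (hx : wittF x = x + wittMap (algebraMap K (SepCl K)) a)
    (Ka : IntermediateField K (SepCl K))
    (hKa : Ka = IntermediateField.adjoin K {α : SepCl K | ∃ j : Fin n, x.coeff j = α})
    (v : Ka → WithTop ℤ) (hv : IsNormVal v) (e : ℕ) (he : ExtendsWithE (lfVal ι) v e)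
    (π : Ka) (hπ : v π = (1 : ℤ))
    (U : ℝ)
    (hU : U = (Finset.Icc r (n - 1)).sup' (Finset.nonempty_Icc.mpr hr2)
      (fun i => (p : ℝ) ^ (n - 1 - i) * (m i : ℝ))) :
    IsUpperBreak K v π U ∧
    ∀ u' : ℝ, IsUpperBreak K v π u' → u' ≤ U := by
  have hp2 := hp.out.two_le
  have hxmem : ∀ j : Fin n, x.coeff j ∈ Ka := fun j => by
    rw [hKa]; exact IntermediateField.subset_adjoin _ _ ⟨j, rfl⟩
  have : CharP (SepCl K) p := charP_of_injective_algebraMap (algebraMap K (SepCl K)).injective p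
  have : CharP Ka p := charP_of_injective_algebraMap (algebraMap K Ka).injective p
  let a' : ℕ → K := fun j => if h : j < n then a.coeff ⟨j, h⟩ else 0
  let x' : ℕ → Ka := fun j => if h : j < n then ⟨x.coeff ⟨j, h⟩, hxmem _⟩ else 0
  let m' : ℕ → ℤ := fun j => -(ι (a' j)).order
  let X : ℕ → SepCl K := fun j => x' j
  let B : ℕ → SepCl K := fun j => algebraMap K (SepCl K) (a' j)
  have hX : ∀ j : Fin n, X j = x.coeff j := by
    intro j; simp only [X, x', dif_pos j.2]
  have ha' : ∀ j : Fin n, a' j = a.coeff j := by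
    intro j; simp only [a', dif_pos j.2]
  have hm' : ∀ j, j < n → m' j = m j := by
    intro j hj
    rw [hm ⟨j, hj⟩]
    simp only [m', a', dif_pos hj]
  have hXB := witt_eq x _ hx X B hX (fun j => by
    simp only [B, ha', wittMap, TruncatedWittVector.coeff_mk])
  -- finiteness
  have hfd : FiniteDimensional K Ka := by
    have hf : Finite {α : SepCl K | ∃ j : Fin n, x.coeff j = α} :=
      Set.finite_range (fun j : Fin n => x.coeff j)
    rw [hKa]
    exact IntermediateField.finiteDimensional_adjoin
      (fun y _ => Algebra.IsIntegral.isIntegral y)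
  have : Normal K Ka := by
    rw [IntermediateField.normal_iff_forall_map_le']
    intro τ
    have : Ka ≤ Ka.comap (τ : SepCl K →ₐ[K] SepCl K) := by
      conv_lhs => rw [hKa]
      rw [IntermediateField.adjoin_le_iff]
      rintro _ ⟨j, rfl⟩
      change τ (x.coeff j) ∈ Ka
      rw [← hX]
      have hY : ∀ j < n, τ (X j) ^ p =
          aeval (Function.uncurry ![fun j => τ (X j), B]) (wittAdd p j) := by
        intro j hj
        have h1 := congrArg τ (hXB j hj)
        rw [map_pow] at h1
        rw [h1]
        have h2 := (MvPolynomial.comp_aeval_apply (Function.uncurry ![X, B])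
          ((τ : SepCl K →+* SepCl K).toIntAlgHom) (wittAdd p j)).symm
        refine Eq.trans h2.symm ?_
        congr 1
        congr 1
        funext s
        obtain ⟨s1, s2⟩ := s
        fin_cases s1
        · rfl
        · exact τ.commutes _
      obtain ⟨C, hC1, hC2⟩ := witt_diff (n := n) X (fun j => τ (X j)) B hXB hY
      rw [hC2 j]
      apply aeval_mem
      rintro ⟨s1, s2⟩ hs
      fin_cases s1
      · exact (x' s2).2
      · exact fp_mem (hC1 s2 (lt_of_le_of_lt hs j.2)) Ka
    exact IntermediateField.map_le_iff_le_comap.2 this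
  have : IsGalois K Ka := ⟨⟩
  obtain ⟨D, hD⟩ := exists_extend_der (L := Ka) (eulerDer ι)
  have har' : a' r = a.coeff ⟨r, hrn⟩ := ha' ⟨r, hrn⟩
  have data : Data v p ι e D n r x' a' m' := by
    refine ⟨hv, he, e_pos ι hv he, hD, ?_, ?_, hrn, fun j => rfl, ?_, ?_⟩
    · intro j hj
      apply (algebraMap Ka (SepCl K)).injective
      have h1 := hXB j hj
      rw [map_pow]
      refine Eq.trans h1 ?_
      have h2 := MvPolynomial.comp_aeval_apply (yy x' a')
          ((algebraMap Ka (SepCl K)).toIntAlgHom) (wittAdd p j)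
      refine Eq.trans ?_ h2.symm
      congr 1
      congr 1
      funext s
      obtain ⟨s1, s2⟩ := s
      fin_cases s1
      · rfl
      · rfl
    · intro j hj
      rw [ha' ⟨j, by omega⟩]
      exact hzero _ hj
    · intro j hj
      have hjn : j < n := by
        by_contra hcon
        exact hj (by simp only [a', dif_neg hcon])
      rw [ha' ⟨j, hjn⟩] at hj
      have h1 := (hstrong ⟨j, hjn⟩).resolve_left hj _ (lfVal_of_ne ι hj)
      rw [hm' j hjn, hm ⟨j, hjn⟩, dvd_neg]
      exact h1
    · rw [hm' r hrn, hm ⟨r, hrn⟩]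
      rw [lfVal_of_ne ι har] at harneg
      have := WithTop.coe_lt_coe.1 harneg
      omega
  have htop : MM K x' n = ⊤ := by
    have h1 : (MM K x' n).map Ka.val = Ka := by
      rw [MM, IntermediateField.adjoin_map]
      conv_rhs => rw [hKa]
      congr 1
      ext t
      constructor
      · rintro ⟨_, ⟨j, hj, rfl⟩, rfl⟩
        exact ⟨⟨j, hj⟩, (hX ⟨j, hj⟩).symm⟩
      · rintro ⟨j, rfl⟩
        exact ⟨x' j, ⟨j, j.2, rfl⟩, hX j⟩
    rw [eq_top_iff]
    intro t _
    have h2 : (t : SepCl K) ∈ (MM K x' n).map Ka.val := by rw [h1]; exact t.2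
    obtain ⟨s, hs, hst⟩ := h2
    have : s = t := Subtype.ext hst
    rwa [← this]
  have hfinal := core data htop π hπ
  have hUU : U = (uu p r m' (n - 1 - r) : ℝ) := by
    rw [hU]
    apply le_antisymm
    · apply Finset.sup'_le
      intro i hi
      rw [Finset.mem_Icc] at hi
      obtain ⟨l, rfl⟩ : ∃ l, i = r + l := ⟨i - r, by omega⟩
      rw [← hm' _ (by omega)]
      have h1 := m_le_uu (p := p) (r := r) (m := m') l
      have h2 := uu_pow_le (p := p) (r := r) (m := m') l (n - 1 - (r + l))
      rw [show l + (n - 1 - (r + l)) = n - 1 - r by omega] at h2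
      have h3 := mul_le_mul_of_nonneg_left h1
        (show (0 : ℤ) ≤ (p : ℤ) ^ (n - 1 - (r + l)) by positivity)
      exact_mod_cast h3.trans h2
    · obtain ⟨l, hl, h1, -, -⟩ := exists_max (p := p) (r := r) (m := m') hp2 data.hmr
        (fun l hl => data.hs _ (by
          intro h0; apply hl; simp [m', h0])) (n - 1 - r)
      rw [h1, hm' _ (by omega)]
      have := Finset.le_sup' (f := fun i => (p : ℝ) ^ (n - 1 - i) * (m i : ℝ))
        (show r + l ∈ Finset.Icc r (n - 1) by rw [Finset.mem_Icc]; omega)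
      refine le_trans (le_of_eq ?_) this
      push_cast
      rw [show n - 1 - r - l = n - 1 - (r + l) by omega]
  rw [hUU]
  exact hfinal

end Red
end S15

/-- the computation of the largest upper break of `L = K[λ_1(a)]` in
the proof of Theorem 7.  Let `K ≅ k((t))` be a local field of characteristic `p > 0`
with perfect residue field `k`, let `1 ≤ r ≤ n-1`, and let
`a = (0, …, 0, a_r, …, a_{n-1}) ∈ W_n(K)` be strongly reduced with `a_r ≠ 0` and
`v_K(a_r) < 0`; set `m_i = -v_K(a_i)`.  Then the largest upper ramification break of
`K[a]/K` (where `K[a] = K(x_0, …, x_{n-1})` for `x` with `F(x) = x ⊕ a`) equals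
`max{p^{n-1-r} m_r, p^{n-2-r} m_{r+1}, …, p m_{n-2}, m_{n-1}}` (terms with `a_i = 0`,
for which `m_i = 0` here, never attain the maximum, so they are effectively omitted). -/
theorem stmt_15 {p : ℕ} [Fact p.Prime] (k : Type) [Field k] [PerfectField k] [CharP k p]
    (K : Type) [Field K] [CharP K p] (ι : K ≃+* LaurentSeries k)
    (n r : ℕ) (hr1 : 1 ≤ r) (hr2 : r ≤ n - 1) (hn : 1 ≤ n)
    (a : TruncatedWittVector p n K)
    (hzero : ∀ j : Fin n, (j : ℕ) < r → a.coeff j = 0)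
    (har : a.coeff ⟨r, by omega⟩ ≠ 0)
    (harneg : lfVal ι (a.coeff ⟨r, by omega⟩) < (0 : ℤ))
    (hstrong : ∀ i : Fin n, a.coeff i = 0 ∨
      ∀ z : ℤ, lfVal ι (a.coeff i) = (z : WithTop ℤ) → ¬ (p : ℤ) ∣ z)
    (m : ℕ → ℤ) (hm : ∀ i : Fin n, m (i : ℕ) = -(ι (a.coeff i)).order)
    (x : TruncatedWittVector p n (SepCl K))
    (hx : wittF x = x + wittMap (algebraMap K (SepCl K)) a)
    (Ka : IntermediateField K (SepCl K))
    (hKa : Ka = IntermediateField.adjoin K {α : SepCl K | ∃ j : Fin n, x.coeff j = α})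
    (v : Ka → WithTop ℤ) (hv : IsNormVal v) (e : ℕ) (he : ExtendsWithE (lfVal ι) v e)
    (π : Ka) (hπ : v π = (1 : ℤ))
    (U : ℝ)
    (hU : U = (Finset.Icc r (n - 1)).sup' (Finset.nonempty_Icc.mpr hr2)
      (fun i => (p : ℝ) ^ (n - 1 - i) * (m i : ℝ))) :
    IsUpperBreak K v π U ∧
    ∀ u' : ℝ, IsUpperBreak K v π u' → u' ≤ U := by
  exact S15.main ι n r hr2 (by omega) a hzero har harneg hstrong m hm x hx Ka hKa v hv e he π hπ U hU
end
end

section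
/- Let K be a local field of characteristic p > 0 with perfect residue field. For every b ∈ W_n(K) there exists c ∈ W_n(K) such that b ⊕ F(c) ⊖ c is reduced. -/
noncomputable section

open scoped Classical

/-- Reducedness of a single component. -/
def CompRed {k : Type*} [Field k] (p : ℕ) (x : LaurentSeries k) : Prop :=
  0 ≤ lsVal x ∨ ∀ z : ℤ, lsVal x = (z : WithTop ℤ) → ¬ (p : ℤ) ∣ z

theorem exists_compRed_aux {p : ℕ} [hp : Fact p.Prime] {k : Type*} [Field k] [PerfectField k]
    [CharP k p] [CharP (LaurentSeries k) p] (N : ℕ) :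
    ∀ a : LaurentSeries k, (∀ i : ℤ, i < -(N : ℤ) → a.coeff i = 0) →
      ∃ d : LaurentSeries k, CompRed p (a + d ^ p - d) := by
  have hp0 : p ≠ 0 := hp.out.ne_zero
  induction N with
  | zero =>
    intro a ha
    refine ⟨0, Or.inl ?_⟩
    simp only [zero_pow hp0, add_zero, sub_zero, lsVal]
    split_ifs with h
    · exact le_top
    · have := (HahnSeries.le_order_iff_forall (i := (0 : ℤ)) h).2 (by simpa using ha)
      exact_mod_cast this
  | succ N ih =>
    intro a ha
    by_cases hc : a.coeff (-((N : ℤ) + 1)) = 0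
    · refine ih a fun i hi => ?_
      rcases eq_or_ne i (-((N : ℤ) + 1)) with rfl | hne
      · exact hc
      · exact ha i (by push_cast; omega)
    have h0 : a ≠ 0 := by rintro rfl; simp at hc
    have hord : a.order = -((N : ℤ) + 1) := by
      apply le_antisymm (HahnSeries.order_le_of_coeff_ne_zero hc)
      refine (HahnSeries.le_order_iff_forall h0).2 fun j hj => ha j (by push_cast; omega)
    by_cases hd : (p : ℤ) ∣ a.order
    · obtain ⟨j, hj⟩ := hd
      obtain ⟨β, hβ⟩ := surjective_frobenius k p (-(a.coeff (-((N : ℤ) + 1))))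
      rw [frobenius_def] at hβ
      have hjneg : j < 0 := by
        have : (0 : ℤ) < p := by exact_mod_cast hp.out.pos
        by_contra hcon
        have := mul_nonneg this.le (not_lt.1 hcon)
        omega
      have hjlt : -((N : ℤ) + 1) < j := by
        have : (2 : ℤ) ≤ p := by exact_mod_cast hp.out.two_le
        nlinarith
      set d₀ : LaurentSeries k := HahnSeries.single j β with hd₀
      have hpow : d₀ ^ p = HahnSeries.single (-((N : ℤ) + 1)) (-(a.coeff (-((N : ℤ) + 1)))) := by
        rw [hd₀, HahnSeries.single_pow, hβ, nsmul_eq_mul, ← hj, hord]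
      obtain ⟨d₁, h₁⟩ := ih (a + d₀ ^ p - d₀) (by
        intro i hi
        rw [hpow, HahnSeries.coeff_sub, HahnSeries.coeff_add, hd₀,
          HahnSeries.coeff_single_of_ne (a := j) (by omega)]
        rcases eq_or_ne i (-((N : ℤ) + 1)) with rfl | hne
        · rw [HahnSeries.coeff_single_same]; ring
        · rw [HahnSeries.coeff_single_of_ne hne, ha i (by push_cast; omega)]; ring)
      refine ⟨d₀ + d₁, ?_⟩
      rw [add_pow_char]
      convert h₁ using 1
      ring
    · refine ⟨0, Or.inr ?_⟩
      simp only [zero_pow hp0, add_zero, sub_zero, lsVal, if_neg h0]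
      intro z hz
      have : a.order = z := by exact_mod_cast hz
      rwa [← this]

theorem exists_compRed {p : ℕ} [hp : Fact p.Prime] {k : Type*} [Field k] [PerfectField k]
    [CharP k p] [CharP (LaurentSeries k) p] (a : LaurentSeries k) :
    ∃ d : LaurentSeries k, CompRed p (a + d ^ p - d) := by
  refine exists_compRed_aux (-a.order).toNat a fun i hi => ?_
  exact HahnSeries.coeff_eq_zero_of_lt_order (by omega)

theorem coeff_add_iterate_verschiebung {p : ℕ} [hp : Fact p.Prime] {R : Type*} [CommRing R]
    (x y : WittVector p R) (m : ℕ) :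
    (∀ i < m, (x + WittVector.verschiebung^[m] y).coeff i = x.coeff i) ∧
      (x + WittVector.verschiebung^[m] y).coeff m = x.coeff m + y.coeff 0 := by
  have hz : ∀ z : WittVector p R, ∀ i, (WittVector.init m x +
      WittVector.verschiebung^[m] z).coeff i =
      (WittVector.init m x).coeff i + (WittVector.verschiebung^[m] z).coeff i := by
    intro z i
    apply WittVector.coeff_add_of_disjoint
    intro j
    by_cases hj : j < m
    · exact Or.inr (WittVector.iterate_verschiebung_coeff_eq_zero _ hj)
    · left
      simp [WittVector.init, WittVector.select, hj]
  have htail : WittVector.tail m x = WittVector.verschiebung^[m] ((WittVector.tail m x).shift m) :=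
    WittVector.eq_iterate_verschiebung fun i hi => by
      simp [WittVector.tail, WittVector.select, hi]
  have hx : x + WittVector.verschiebung^[m] y = WittVector.init m x +
      WittVector.verschiebung^[m] ((WittVector.tail m x).shift m + y) := by
    rw [iterate_map_add, ← htail, ← add_assoc, WittVector.init_add_tail]
  rw [hx]
  constructor
  · intro i hi
    rw [hz, WittVector.iterate_verschiebung_coeff_eq_zero _ hi]
    simp [WittVector.init, WittVector.select, hi]
  · rw [hz]
    have := WittVector.iterate_verschiebung_coeff ((WittVector.tail m x).shift m + y) m 0
    rw [zero_add] at this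
    rw [this, WittVector.add_coeff_zero, WittVector.shift_coeff]
    simp [WittVector.init, WittVector.tail, WittVector.select]

theorem witt_reduce {p : ℕ} [hp : Fact p.Prime] {K : Type*} [Field K] [CharP K p] (P : K → Prop)
    (hP : ∀ a : K, ∃ d : K, P (a + d ^ p - d)) (b : WittVector p K) (m : ℕ) :
    ∃ c : WittVector p K, ∀ i < m, P ((b + WittVector.frobenius c - c).coeff i) := by
  induction m with
  | zero => exact ⟨0, fun i hi => absurd hi (Nat.not_lt_zero i)⟩
  | succ m ih =>
    obtain ⟨c, hc⟩ := ih
    set a := b + WittVector.frobenius c - c with ha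
    obtain ⟨d, hd⟩ := hP (a.coeff m)
    set t : WittVector p K := WittVector.teichmuller p d with ht
    have key : b + WittVector.frobenius (c + WittVector.verschiebung^[m] t) -
        (c + WittVector.verschiebung^[m] t) =
        a + WittVector.verschiebung^[m] (WittVector.frobenius t - t) := by
      have hcomm : WittVector.frobenius (WittVector.verschiebung^[m] t) =
          WittVector.verschiebung^[m] (WittVector.frobenius t) :=
        ((WittVector.verschiebung_frobenius_comm (p := p) (R := K)).iterate_left m t).symm
      rw [map_add, hcomm, iterate_map_sub, ha]
      ring
    refine ⟨c + WittVector.verschiebung^[m] t, fun i hi => ?_⟩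
    rw [key]
    obtain ⟨h1, h2⟩ := coeff_add_iterate_verschiebung a (WittVector.frobenius t - t) m
    rcases Nat.lt_succ_iff_lt_or_eq.1 hi with hlt | rfl
    · rw [h1 i hlt]; exact hc i hlt
    · have hs : (WittVector.frobenius t - t).coeff 0 = (WittVector.frobenius t).coeff 0 - t.coeff 0 :=
        map_sub (WittVector.constantCoeff (p := p) (R := K)) _ _
      rw [h2, hs, WittVector.coeff_frobenius_charP,
        WittVector.teichmuller_coeff_zero, ← add_sub_assoc]
      exact hd

/-- Proposition 4.1 of Thomas, quoted in the paper.  Let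
`K ≅ k((t))` be a local field of characteristic `p > 0` with perfect residue field
`k`.  For every `b ∈ W_n(K)` there exists `c ∈ W_n(K)` such that `b ⊕ F(c) ⊖ c` is
reduced, i.e. each component `a_i` of `b ⊕ F(c) ⊖ c` satisfies `v_K(a_i) ≥ 0` or
`p ∤ v_K(a_i)`. -/
theorem stmt_16 {p : ℕ} [Fact p.Prime] (k : Type) [Field k] [PerfectField k] [CharP k p]
    (K : Type) [Field K] [CharP K p] (ι : K ≃+* LaurentSeries k)
    (n : ℕ) (b : TruncatedWittVector p n K) :
    ∃ c : TruncatedWittVector p n K,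
      ∀ i : Fin n, 0 ≤ lfVal ι ((b + wittF c - c).coeff i) ∨
        ∀ z : ℤ, lfVal ι ((b + wittF c - c).coeff i) = (z : WithTop ℤ) → ¬ (p : ℤ) ∣ z := by
  have : CharP (LaurentSeries k) p :=
    charP_of_injective_ringHom (f := (ι : K →+* LaurentSeries k)) ι.injective p
  obtain ⟨b', rfl⟩ := WittVector.truncate_surjective p n K b
  obtain ⟨c, hc⟩ := witt_reduce (fun x : K => CompRed p (ι x)) (fun a => by
    obtain ⟨d, hd⟩ := exists_compRed (p := p) (ι a)
    refine ⟨ι.symm d, ?_⟩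
    simpa using hd) b' n
  have hF : wittF (WittVector.truncate n c) = WittVector.truncate n (WittVector.frobenius c) := by
    ext i
    simp [wittF, WittVector.coeff_frobenius_charP]
  refine ⟨WittVector.truncate n c, fun i => ?_⟩
  rw [hF, ← map_add, ← map_sub, WittVector.coeff_truncate]
  exact hc i i.2
end
end
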